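/- There is a constant b₀ > 0 such that for every λ > 0 and every finite connected transitive graph 𝔾 satisfying the triangle condition ∇_{p_c}(x,y) ≤ δ_{x,y} + a₀ with a₀ ≤ b₀ and λV^{1/3} ≥ b₀^{-1}, the following holds for p = p_c + εΩ^{-1} with ε ≥ 0 (and p ≤ 1): (i) 𝔼_p|C_max| ≤ 21εV + 7V^{2/3}; and (ii) for every ω > 0, ℙ_p(|C_max| ≥ ω(V^{2/3} + εV)) ≤ 21/ω. -/

import Mathlib

noncomputable section
open Classical

namespace Percolation

variable {V : Type*} [Fintype V] [DecidableEq V]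

/-- A percolation configuration: an assignment of occupied (`true`) or
vacant (`false`) to each bond of the graph. -/
def Config (G : SimpleGraph V) : Type _ := G.edgeSet → Bool

noncomputable instance (G : SimpleGraph V) : Fintype G.edgeSet :=
  Fintype.ofFinite _

noncomputable instance (G : SimpleGraph V) : Fintype (Config G) :=
  inferInstanceAs (Fintype (G.edgeSet → Bool))

/-- The probability weight of a configuration under the product Bernoulli
measure with parameter `p`. -/
def weight (G : SimpleGraph V) (p : ℝ) (ω : Config G) : ℝ :=
  ∏ e : G.edgeSet, if ω e then p else 1 - p

/-- The probability of an event under the percolation measure `ℙ_p`. -/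
def prob (G : SimpleGraph V) (p : ℝ) (A : Config G → Prop) : ℝ :=
  ∑ ω : Config G, if A ω then weight G p ω else 0

/-- The expectation of a random variable under the percolation measure `ℙ_p`. -/
def expect (G : SimpleGraph V) (p : ℝ) (f : Config G → ℝ) : ℝ :=
  ∑ ω : Config G, weight G p ω * f ω

/-- The subgraph consisting of the occupied bonds of a configuration. -/
def occupied (G : SimpleGraph V) (ω : Config G) : SimpleGraph V :=
  SimpleGraph.fromEdgeSet {e | ∃ h : e ∈ G.edgeSet, ω ⟨e, h⟩ = true}

/-- The cluster `C(x)` of the vertex `x`: all vertices joined to `x` by a path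
of occupied bonds (including `x` itself). -/
def cluster (G : SimpleGraph V) (ω : Config G) (x : V) : Finset V :=
  Finset.univ.filter fun y => (occupied G ω).Reachable x y

/-- The susceptibility `χ(p)`: the expected size of the cluster of `x₀`. -/
def chi (G : SimpleGraph V) (x₀ : V) (p : ℝ) : ℝ :=
  expect G p fun ω => ((cluster G ω x₀).card : ℝ)

/-- The two-point function `τ_p(x,y) = ℙ_p(x ↔ y)`. -/
def tau (G : SimpleGraph V) (p : ℝ) (x y : V) : ℝ :=
  prob G p fun ω => (occupied G ω).Reachable x y

/-- The triangle diagram `∇_p(x,y)`. -/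
def triangle (G : SimpleGraph V) (p : ℝ) (x y : V) : ℝ :=
  ∑ u : V, ∑ v : V, tau G p x u * tau G p u v * tau G p v y

/-- The Kronecker delta `δ_{x,y}`. -/
def kron (x y : V) : ℝ := if x = y then 1 else 0

/-- `∇̄_p`: the maximum of the triangle diagram over bonds `{x,y} ∈ 𝔹`. -/
def nablaBar (G : SimpleGraph V) (p : ℝ) : ℝ :=
  sSup {t : ℝ | ∃ x y : V, G.Adj x y ∧ t = triangle G p x y}

/-- A graph is (vertex-)transitive if any vertex can be mapped to any other
by a graph automorphism. -/
def IsTransitive (G : SimpleGraph V) : Prop :=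
  ∀ x y : V, ∃ φ : G ≃g G, φ x = y

/-- The size `|C_max|` of the largest cluster. -/
def maxCluster (G : SimpleGraph V) (ω : Config G) : ℕ :=
  Finset.univ.sup fun x => (cluster G ω x).card

/-- The cluster size distribution `P_{≥k}(p) = ℙ_p(|C(x₀)| ≥ k)`. -/
def Pgeq (G : SimpleGraph V) (x₀ : V) (p : ℝ) (k : ℝ) : ℝ :=
  prob G p fun ω => k ≤ ((cluster G ω x₀).card : ℝ)

/-- The magnetization `M(p,γ)`. -/
def magnetization (G : SimpleGraph V) (x₀ : V) (p γ : ℝ) : ℝ :=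
  ∑ k ∈ Finset.Icc 1 (Fintype.card V),
    (1 - (1 - γ) ^ k) * prob G p fun ω => (cluster G ω x₀).card = k

/-- `Z_{≥s}`: the number of vertices lying in clusters of size at least `s`. -/
def Zgeq (G : SimpleGraph V) (s : ℝ) (ω : Config G) : ℝ :=
  ∑ x : V, if s ≤ ((cluster G ω x).card : ℝ) then (1 : ℝ) else 0

/-- The variance of a random variable under `ℙ_p`. -/
def variance (G : SimpleGraph V) (p : ℝ) (f : Config G → ℝ) : ℝ :=
  expect G p (fun ω => f ω ^ 2) - (expect G p f) ^ 2

/-- The restricted susceptibility `χ_{≥s}(p) = 𝔼_p[|C(x₀)| I[|C(x₀)| ≥ s]]`. -/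
def chiGeq (G : SimpleGraph V) (x₀ : V) (p : ℝ) (s : ℝ) : ℝ :=
  expect G p fun ω =>
    if s ≤ ((cluster G ω x₀).card : ℝ) then ((cluster G ω x₀).card : ℝ) else 0

/-- The restricted susceptibility `χ_{<s}(p) = 𝔼_p[|C(x₀)| I[|C(x₀)| < s]]`. -/
def chiLt (G : SimpleGraph V) (x₀ : V) (p : ℝ) (s : ℝ) : ℝ :=
  expect G p fun ω =>
    if ((cluster G ω x₀).card : ℝ) < s then ((cluster G ω x₀).card : ℝ) else 0

end Percolation

namespace Perc2

/-- Expectation under product Bernoulli measure on subsets of `E`. -/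
def Ex {α : Type*} (E : Finset α) (p : ℝ) (f : Finset α → ℝ) : ℝ :=
  ∑ S ∈ E.powerset, p ^ S.card * (1 - p) ^ (E.card - S.card) * f S

/-- Indicator. -/
def ind (P : Prop) : ℝ := if P then 1 else 0

theorem ind_nonneg (P : Prop) : 0 ≤ ind P := by
  unfold ind; split_ifs <;> norm_num

theorem ind_le_one (P : Prop) : ind P ≤ 1 := by
  unfold ind; split_ifs <;> norm_num

theorem ind_true {P : Prop} (h : P) : ind P = 1 := by simp [ind, h]

theorem ind_false {P : Prop} (h : ¬ P) : ind P = 0 := by simp [ind, h]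

theorem ind_mono {P Q : Prop} (h : P → Q) : ind P ≤ ind Q := by
  unfold ind; split_ifs <;> first | (exfalso; tauto) | norm_num

theorem ind_congr {P Q : Prop} (h : P ↔ Q) : ind P = ind Q := by
  unfold ind; simp [h]

theorem ind_and (P Q : Prop) : ind (P ∧ Q) = ind P * ind Q := by
  unfold ind; split_ifs <;> first | (exfalso; tauto) | norm_num

theorem ind_not (P : Prop) : ind (¬ P) = 1 - ind P := by
  unfold ind; split_ifs <;> norm_num

section basics
variable {α : Type*} {E : Finset α} {p : ℝ}

theorem Ex_empty (f : Finset α → ℝ) : Ex ∅ p f = f ∅ := by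
  simp [Ex]

theorem Ex_insert {e : α} (he : e ∉ E) (f : Finset α → ℝ) :
    Ex (insert e E) p f = p * Ex E p (fun S => f (insert e S)) + (1 - p) * Ex E p f := by
  unfold Ex
  rw [Finset.sum_powerset_insert he, Finset.mul_sum, Finset.mul_sum, add_comm]
  congr 1
  · refine Finset.sum_congr rfl fun S hS => ?_
    have hS' := Finset.mem_powerset.1 hS
    have : e ∉ S := fun h => he (hS' h)
    rw [Finset.card_insert_of_notMem this, Finset.card_insert_of_notMem he]
    rw [Nat.add_sub_add_right]
    ring
  · refine Finset.sum_congr rfl fun S hS => ?_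
    have hS' := Finset.card_le_card (Finset.mem_powerset.1 hS)
    rw [Finset.card_insert_of_notMem he, Nat.sub_add_comm hS']
    ring

theorem Ex_congr {f g : Finset α → ℝ} (h : ∀ S, S ⊆ E → f S = g S) : Ex E p f = Ex E p g := by
  unfold Ex
  refine Finset.sum_congr rfl fun S hS => ?_
  rw [h S (Finset.mem_powerset.1 hS)]

theorem Ex_mono (hp0 : 0 ≤ p) (hp1 : p ≤ 1) {f g : Finset α → ℝ} (h : ∀ S, S ⊆ E → f S ≤ g S) :
    Ex E p f ≤ Ex E p g := by
  unfold Ex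
  refine Finset.sum_le_sum fun S hS => ?_
  have := h S (Finset.mem_powerset.1 hS)
  have h1 : 0 ≤ 1 - p := by linarith
  gcongr

theorem Ex_add (f g : Finset α → ℝ) : Ex E p (fun S => f S + g S) = Ex E p f + Ex E p g := by
  unfold Ex; rw [← Finset.sum_add_distrib]
  exact Finset.sum_congr rfl fun S _ => by ring

theorem Ex_sub (f g : Finset α → ℝ) : Ex E p (fun S => f S - g S) = Ex E p f - Ex E p g := by
  unfold Ex; rw [← Finset.sum_sub_distrib]
  exact Finset.sum_congr rfl fun S _ => by ring

theorem Ex_mul_left (c : ℝ) (f : Finset α → ℝ) : Ex E p (fun S => c * f S) = c * Ex E p f := by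
  unfold Ex; rw [Finset.mul_sum]
  exact Finset.sum_congr rfl fun S _ => by ring

theorem Ex_mul_right (c : ℝ) (f : Finset α → ℝ) : Ex E p (fun S => f S * c) = Ex E p f * c := by
  unfold Ex; rw [Finset.sum_mul]
  exact Finset.sum_congr rfl fun S _ => by ring

theorem Ex_sum {ι : Type*} (s : Finset ι) (f : ι → Finset α → ℝ) :
    Ex E p (fun S => ∑ i ∈ s, f i S) = ∑ i ∈ s, Ex E p (f i) := by
  unfold Ex; rw [Finset.sum_comm]
  exact Finset.sum_congr rfl fun S _ => by rw [Finset.mul_sum]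

theorem Ex_const (c : ℝ) : Ex E p (fun _ => c) = c := by
  induction E using Finset.induction_on with
  | empty => simp [Ex_empty]
  | insert e E he ih => rw [Ex_insert he, ih]; ring

theorem Ex_comm {β : Type*} (F : Finset β) (r : ℝ) (f : Finset α → Finset β → ℝ) :
    Ex E p (fun S => Ex F r (fun T => f S T)) = Ex F r (fun T => Ex E p (fun S => f S T)) := by
  unfold Ex
  simp_rw [Finset.mul_sum]
  rw [Finset.sum_comm]
  exact Finset.sum_congr rfl fun S _ => Finset.sum_congr rfl fun T _ => by ring

theorem Ex_nonneg (hp0 : 0 ≤ p) (hp1 : p ≤ 1) {f : Finset α → ℝ} (h : ∀ S, S ⊆ E → 0 ≤ f S) :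
    0 ≤ Ex E p f := by
  have := Ex_mono (E := E) hp0 hp1 (f := fun _ => 0) (g := f) h
  rwa [Ex_const] at this

/-- Independence of functions of disjoint sets of coordinates. -/
theorem Ex_indep (P : α → Prop) (f g : Finset α → ℝ)
    (hf : ∀ S T : Finset α, (∀ e, P e → (e ∈ S ↔ e ∈ T)) → f S = f T)
    (hg : ∀ S T : Finset α, (∀ e, ¬ P e → (e ∈ S ↔ e ∈ T)) → g S = g T) :
    Ex E p (fun S => f S * g S) = Ex E p f * Ex E p g := by
  induction E using Finset.induction_on generalizing f g with
  | empty => simp [Ex_empty]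
  | insert e E he ih =>
    rw [Ex_insert he, Ex_insert he, Ex_insert he]
    by_cases hP : P e
    · have h2 : ∀ S, g (insert e S) = g S := fun S => hg _ _ fun e' he' => by
        have : e' ≠ e := fun h => he' (h ▸ hP)
        simp [this]
      simp_rw [h2]
      rw [ih f g hf hg, ih (fun S => f (insert e S)) g ?_ hg]
      · ring
      · intro S T h
        refine hf _ _ fun e' he' => ?_
        simp [h e' he']
    · have h2 : ∀ S, f (insert e S) = f S := fun S => hf _ _ fun e' he' => by
        have : e' ≠ e := fun h => hP (h ▸ he')
        simp [this]
      simp_rw [h2]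
      rw [ih f g hf hg, ih f (fun S => g (insert e S)) hf ?_]
      · ring
      · intro S T h
        refine hg _ _ fun e' he' => ?_
        simp [h e' he']

def disj (A B : Finset α → Prop) (S : Finset α) : Prop :=
  ∃ X Y : Finset α, X ⊆ S ∧ Y ⊆ S ∧ Disjoint X Y ∧ A X ∧ B Y

/-- Increasing event. -/
def Inc (A : Finset α → Prop) : Prop := ∀ S T : Finset α, S ⊆ T → A S → A T

theorem disj_inc {A B : Finset α → Prop} : Inc (disj A B) := by
  rintro S T hST ⟨X, Y, hX, hY, h⟩
  exact ⟨X, Y, hX.trans hST, hY.trans hST, h⟩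

theorem Inc_insert {A : Finset α → Prop} (hA : Inc A) (e : α) : Inc (fun S => A (insert e S)) :=
  fun _ _ h => hA _ _ (Finset.insert_subset_insert e h)

/-- BK inequality for increasing events, `p ≤ 1/2`. -/
theorem BK (hp0 : 0 ≤ p) (hp1 : p ≤ 1 / 2) {A B : Finset α → Prop} (hA : Inc A) (hB : Inc B) :
    Ex E p (fun S => ind (disj A B S)) ≤
      Ex E p (fun S => ind (A S)) * Ex E p (fun S => ind (B S)) := by
  induction E using Finset.induction_on generalizing A B with
  | empty =>
    rw [Ex_empty, Ex_empty, Ex_empty, ← ind_and]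
    refine ind_mono ?_
    rintro ⟨X, Y, hX, hY, -, h1, h2⟩
    exact ⟨hA _ _ hX h1, hB _ _ hY h2⟩
  | insert e E he ih =>
    rw [Ex_insert he, Ex_insert he, Ex_insert he]
    have hA1 := Inc_insert hA e
    have hB1 := Inc_insert hB e
    set a0 := Ex E p (fun S => ind (A S))
    set b0 := Ex E p (fun S => ind (B S))
    set a1 := Ex E p (fun S => ind (A (insert e S)))
    set b1 := Ex E p (fun S => ind (B (insert e S)))
    have h00 := ih hA hB
    have h10 := ih hA1 hB
    have h01 := ih hA hB1
    have hp1' : p ≤ 1 := by linarith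
    have ha : a0 ≤ a1 := Ex_mono hp0 hp1' fun S _ =>
      ind_mono (hA _ _ (Finset.subset_insert e S))
    have hb : b0 ≤ b1 := Ex_mono hp0 hp1' fun S _ =>
      ind_mono (hB _ _ (Finset.subset_insert e S))
    have key : Ex E p (fun S => ind (disj A B (insert e S))) ≤
        Ex E p (fun S => ind (disj (fun S => A (insert e S)) B S)) +
        Ex E p (fun S => ind (disj A (fun S => B (insert e S)) S)) -
        Ex E p (fun S => ind (disj A B S)) := by
      rw [← Ex_add, ← Ex_sub]
      refine Ex_mono hp0 hp1' fun S hS => ?_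
      have heS : e ∉ S := fun h => he (hS h)
      have i1 : disj A B S → disj (fun S => A (insert e S)) B S := by
        rintro ⟨X, Y, hX, hY, hd, h1, h2⟩
        exact ⟨X, Y, hX, hY, hd, hA _ _ (Finset.subset_insert e X) h1, h2⟩
      have i2 : disj A B S → disj A (fun S => B (insert e S)) S := by
        rintro ⟨X, Y, hX, hY, hd, h1, h2⟩
        exact ⟨X, Y, hX, hY, hd, h1, hB _ _ (Finset.subset_insert e Y) h2⟩
      have i3 : disj A B (insert e S) → disj (fun S => A (insert e S)) B S ∨
          disj A (fun S => B (insert e S)) S := by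
        rintro ⟨X, Y, hX, hY, hd, h1, h2⟩
        by_cases heX : e ∈ X
        · left
          have heY : e ∉ Y := Finset.disjoint_left.1 hd heX
          refine ⟨X.erase e, Y, ?_, ?_, ?_, ?_, h2⟩
          · rwa [← Finset.subset_insert_iff]
          · rwa [Finset.subset_insert_iff_of_notMem heY] at hY
          · exact hd.mono_left (Finset.erase_subset _ _)
          · simpa [Finset.insert_erase heX] using h1
        · right
          refine ⟨X, Y.erase e, ?_, ?_, ?_, h1, ?_⟩
          · rwa [Finset.subset_insert_iff_of_notMem heX] at hX
          · rwa [← Finset.subset_insert_iff]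
          · exact hd.mono_right (Finset.erase_subset _ _)
          · exact hB _ _ (Finset.insert_erase_subset e Y) h2
      have n1 := ind_nonneg (disj (fun S => A (insert e S)) B S)
      have n2 := ind_nonneg (disj A (fun S => B (insert e S)) S)
      by_cases h0 : disj A B S
      · rw [ind_true (i1 h0), ind_true (i2 h0), ind_true h0]
        linarith [ind_le_one (disj A B (insert e S))]
      · by_cases h : disj A B (insert e S)
        · rw [ind_true h, ind_false h0]
          rcases i3 h with h' | h'
          · rw [ind_true h']; linarith
          · rw [ind_true h']; linarith
        · rw [ind_false h, ind_false h0]; linarith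
    have hd0 : 0 ≤ Ex E p (fun S => ind (disj A B S)) := Ex_nonneg hp0 hp1' fun S _ => ind_nonneg _
    nlinarith [mul_nonneg (mul_nonneg hp0 hp0) (mul_nonneg (sub_nonneg.2 ha) (sub_nonneg.2 hb)),
      mul_le_mul_of_nonneg_left key hp0, mul_le_mul_of_nonneg_left h10 hp0,
      mul_le_mul_of_nonneg_left h01 hp0,
      mul_le_mul_of_nonneg_left h00 (show 0 ≤ 1 - 2 * p by linarith)]

/-- Opening a bond. -/
theorem Ex_open {e : α} (he : e ∈ E) (hp0 : 0 ≤ p) (hp1 : p ≤ 1) (h : Finset α → ℝ)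
    (hh : ∀ S, 0 ≤ h S) :
    p * Ex E p (fun S => ind (e ∉ S) * h S) ≤ Ex E p (fun S => ind (e ∈ S) * h (S.erase e)) := by
  obtain ⟨E0, he0, rfl⟩ : ∃ E0, e ∉ E0 ∧ E = insert e E0 :=
    ⟨E.erase e, Finset.notMem_erase e E, (Finset.insert_erase he).symm⟩
  rw [Ex_insert he0, Ex_insert he0]
  have h1 : Ex E0 p (fun S => ind (e ∉ insert e S) * h (insert e S)) = 0 := by
    rw [← Ex_const (E := E0) (p := p) 0]
    exact Ex_congr fun S _ => by simp [ind]
  have h2 : Ex E0 p (fun S => ind (e ∉ S) * h S) = Ex E0 p h :=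
    Ex_congr fun S hS => by
      have : e ∉ S := fun h => he0 (hS h)
      simp [ind, this]
  have h3 : Ex E0 p (fun S => ind (e ∈ insert e S) * h ((insert e S).erase e)) = Ex E0 p h :=
    Ex_congr fun S hS => by
      have : e ∉ S := fun h => he0 (hS h)
      simp [ind, this]
  have h4 : 0 ≤ Ex E0 p (fun S => ind (e ∈ S) * h (S.erase e)) :=
    Ex_nonneg hp0 hp1 fun S _ => mul_nonneg (ind_nonneg _) (hh _)
  have h5 : 0 ≤ Ex E0 p h := Ex_nonneg hp0 hp1 fun S _ => hh _
  rw [h1, h2, h3]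
  nlinarith [mul_nonneg (sub_nonneg.2 hp1) h4, mul_nonneg hp0 (mul_nonneg hp0 h5)]

theorem Ex_mem {e : α} (he : e ∈ E) : Ex E p (fun S => ind (e ∈ S)) = p := by
  obtain ⟨E0, he0, rfl⟩ : ∃ E0, e ∉ E0 ∧ E = insert e E0 :=
    ⟨E.erase e, Finset.notMem_erase e E, (Finset.insert_erase he).symm⟩
  rw [Ex_insert he0]
  have h1 : Ex E0 p (fun S => ind (e ∈ insert e S)) = 1 := by
    rw [← Ex_const (E := E0) (p := p) 1]
    exact Ex_congr fun S _ => by simp [ind]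
  have h2 : Ex E0 p (fun S => ind (e ∈ S)) = 0 := by
    rw [← Ex_const (E := E0) (p := p) 0]
    refine Ex_congr fun S hS => ?_
    have : e ∉ S := fun h => he0 (hS h)
    simp [ind, this]
  rw [h1, h2]; ring

theorem Ex_russo {e : α} (he : e ∈ E) (f : Finset α → ℝ) :
    (1 - p) * Ex E p (fun S => f (insert e S) - f (S.erase e)) =
      Ex E p (fun S => f (insert e S) - f S) := by
  obtain ⟨E0, he0, rfl⟩ : ∃ E0, e ∉ E0 ∧ E = insert e E0 :=
    ⟨E.erase e, Finset.notMem_erase e E, (Finset.insert_erase he).symm⟩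
  rw [Ex_insert he0, Ex_insert he0]
  have h1 : Ex E0 p (fun S => f (insert e (insert e S)) - f (insert e S)) = 0 := by
    rw [← Ex_const (E := E0) (p := p) 0]
    exact Ex_congr fun S _ => by simp
  have h2 : Ex E0 p (fun S => f (insert e (insert e S)) - f ((insert e S).erase e)) =
      Ex E0 p (fun S => f (insert e S) - f S) := by
    refine Ex_congr fun S hS => ?_
    have : e ∉ S := fun h => he0 (hS h)
    simp [this]
  have h3 : Ex E0 p (fun S => f (insert e S) - f (S.erase e)) =
      Ex E0 p (fun S => f (insert e S) - f S) := by
    refine Ex_congr fun S hS => ?_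
    have : e ∉ S := fun h => he0 (hS h)
    simp [this]
  rw [h1, h2, h3]; ring

theorem Ex_hasDerivAt (P : ℝ → ℝ) (P' t : ℝ) (hP : HasDerivAt P P' t)
    (F : ℝ → Finset α → ℝ) (F' : Finset α → ℝ)
    (hF : ∀ S, HasDerivAt (fun t => F t S) (F' S) t) :
    HasDerivAt (fun t => Ex E (P t) (F t))
      (P' * (∑ e ∈ E, Ex E (P t) (fun S => F t (insert e S) - F t (S.erase e))) +
        Ex E (P t) F') t := by
  induction E using Finset.induction_on generalizing F F' with
  | empty => simpa [Ex_empty] using hF ∅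
  | insert j E hj ih =>
    simp_rw [Ex_insert hj]
    have i1 := ih (fun t S => F t (insert j S)) (fun S => F' (insert j S)) (fun S => hF _)
    have i0 := ih F F' hF
    have := (hP.mul i1).add (((hasDerivAt_const t 1).sub hP).mul i0)
    refine this.congr_deriv ?_
    rw [Finset.sum_insert hj]
    have h1 : Ex E (P t) (fun S => F t (insert j (insert j S)) - F t ((insert j S).erase j)) =
        Ex E (P t) (fun S => F t (insert j S)) - Ex E (P t) (F t) := by
      rw [← Ex_sub]
      refine Ex_congr fun S hS => ?_
      have : j ∉ S := fun h => hj (hS h)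
      simp [this]
    have h2 : Ex E (P t) (fun S => F t (insert j S) - F t (S.erase j)) =
        Ex E (P t) (fun S => F t (insert j S)) - Ex E (P t) (F t) := by
      rw [← Ex_sub]
      refine Ex_congr fun S hS => ?_
      have : j ∉ S := fun h => hj (hS h)
      simp [this]
    rw [h1, h2, Finset.sum_add_distrib, ← Finset.mul_sum, ← Finset.mul_sum]
    have h3 : ∑ e ∈ E, Ex E (P t) (fun S => F t (insert e (insert j S)) - F t ((insert j S).erase e))
        = ∑ e ∈ E, Ex E (P t) (fun S => F t (insert j (insert e S)) - F t (insert j (S.erase e))) := by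
      refine Finset.sum_congr rfl fun e he => Ex_congr fun S hS => ?_
      have : e ≠ j := fun h => hj (h ▸ he)
      rw [Finset.insert_comm, Finset.erase_insert_of_ne this.symm]
    rw [h3]
    simp only [Pi.sub_apply]
    ring

theorem Ex_disjoint (C : Finset α) (r : ℝ) :
    Ex E r (fun T => ind (Disjoint C T)) = (1 - r) ^ (E.filter (· ∈ C)).card := by
  induction E using Finset.induction_on with
  | empty => simp [Ex_empty, ind]
  | insert j E hj ih =>
    rw [Ex_insert hj, ih, Finset.filter_insert]
    by_cases h : j ∈ C
    · have h1 : Ex E r (fun T => ind (Disjoint C (insert j T))) = 0 := by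
        rw [← Ex_const (E := E) (p := r) 0]
        exact Ex_congr fun S _ => by simp [ind, h]
      rw [h1, if_pos h, Finset.card_insert_of_notMem (by simp [hj])]
      ring
    · have h1 : Ex E r (fun T => ind (Disjoint C (insert j T))) =
          Ex E r (fun T => ind (Disjoint C T)) := by
        exact Ex_congr fun S _ => by simp [ind, h]
      rw [h1, if_neg h, ih]
      ring

end basics

section graph
variable {V : Type*}

/-- Connectivity through a set of bonds. -/
def R (S : Finset (Sym2 V)) (x y : V) : Prop :=
  (SimpleGraph.fromEdgeSet (S : Set (Sym2 V))).Reachable x y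

theorem R_iff (S : Finset (Sym2 V)) (x y : V) :
    R S x y ↔ Relation.ReflTransGen (fun a b => s(a, b) ∈ S) x y := by
  unfold R
  rw [SimpleGraph.reachable_iff_reflTransGen]
  constructor
  · intro h
    refine Relation.ReflTransGen.mono (fun a b hab => ?_) _ _ h
    simpa using (SimpleGraph.fromEdgeSet_adj _).1 hab |>.1
  · intro h
    induction h with
    | refl => exact Relation.ReflTransGen.refl
    | @tail b c _ hbc ih =>
      by_cases h : b = c
      · exact h ▸ ih
      · exact ih.tail ((SimpleGraph.fromEdgeSet_adj _).2 ⟨by simpa using hbc, h⟩)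

theorem R_refl (S : Finset (Sym2 V)) (x : V) : R S x x := SimpleGraph.Reachable.refl x

theorem R_symm {S : Finset (Sym2 V)} {x y : V} (h : R S x y) : R S y x :=
  SimpleGraph.Reachable.symm h

theorem R_comm {S : Finset (Sym2 V)} {x y : V} : R S x y ↔ R S y x := ⟨R_symm, R_symm⟩

theorem R_trans {S : Finset (Sym2 V)} {x y z : V} (h : R S x y) (h' : R S y z) : R S x z :=
  SimpleGraph.Reachable.trans h h'

theorem R_mono {S T : Finset (Sym2 V)} (hST : S ⊆ T) {x y : V} (h : R S x y) : R T x y := by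
  rw [R_iff] at *
  exact Relation.ReflTransGen.mono (fun a b hab => hST hab) _ _ h

theorem R_step {S : Finset (Sym2 V)} {x y : V} (h : s(x, y) ∈ S) : R S x y := by
  rw [R_iff]; exact Relation.ReflTransGen.single h

/-- Induction from the end. -/
theorem R_ind {S : Finset (Sym2 V)} {x y : V} (h : R S x y) (P : V → Prop) (h0 : P x)
    (hs : ∀ b c, R S x b → P b → s(b, c) ∈ S → P c) : P y := by
  rw [R_iff] at h
  induction h with
  | refl => exact h0
  | @tail b c hb hbc ih => exact hs b c ((R_iff _ _ _).2 hb) ih hbc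

theorem R_inc (x y : V) : Inc (fun S : Finset (Sym2 V) => R S x y) := fun _ _ h => R_mono h

/-- Splitting a path. -/
theorem exists_path_split {S : Finset (Sym2 V)} {x y : V} (h : R S x y) :
    ∃ L : Finset V, x ∈ L ∧ y ∈ L ∧ (∃ X : Finset (Sym2 V), X ⊆ S ∧ R X x y ∧
      ∀ e ∈ X, ∀ a ∈ e, a ∈ L) ∧
      ∀ w ∈ L, ∃ X Y : Finset (Sym2 V), X ⊆ S ∧ Y ⊆ S ∧ Disjoint X Y ∧ R X x w ∧ R Y w y ∧
        (∀ e ∈ X, ∀ a ∈ e, a ∈ L) ∧ (∀ e ∈ Y, ∀ a ∈ e, a ∈ L) := by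
  obtain ⟨q, hq⟩ := h.exists_isPath
  have hR : ∀ {a b : V} (r : (SimpleGraph.fromEdgeSet (S : Set (Sym2 V))).Walk a b),
      R r.edges.toFinset a b := by
    intro a b r
    induction r with
    | nil => exact R_refl _ _
    | cons hadj r ih =>
      refine R_trans (R_step ?_) (R_mono ?_ ih)
      · simp
      · intro e he; simp at he ⊢; exact Or.inr he
  have hsub : ∀ e ∈ q.edges, e ∈ S := by
    intro e he
    have := q.edges_subset_edgeSet he
    rw [SimpleGraph.edgeSet_fromEdgeSet] at this
    exact_mod_cast this.1
  have hL : ∀ e ∈ q.edges, ∀ a ∈ e, a ∈ q.support := by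
    intro e he a ha
    exact q.mem_support_of_mem_edges he ha
  refine ⟨q.support.toFinset, by simp, by simp, ⟨q.edges.toFinset, ?_, hR q, ?_⟩, ?_⟩
  · intro e he; exact hsub e (by simpa using he)
  · intro e he a ha
    simpa using hL e (by simpa using he) a ha
  · intro w hw
    have hw' : w ∈ q.support := by simpa using hw
    have hspec := q.take_spec hw'
    have hed : q.edges = (q.takeUntil w hw').edges ++ (q.dropUntil w hw').edges := by
      rw [← SimpleGraph.Walk.edges_append, hspec]
    have hnd : q.edges.Nodup := hq.isTrail.edges_nodup
    rw [hed, List.nodup_append'] at hnd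
    refine ⟨(q.takeUntil w hw').edges.toFinset, (q.dropUntil w hw').edges.toFinset,
      ?_, ?_, ?_, hR _, hR _, ?_, ?_⟩
    · intro e he
      refine hsub e ?_
      rw [hed]; simp at he ⊢; exact Or.inl he
    · intro e he
      refine hsub e ?_
      rw [hed]; simp at he ⊢; exact Or.inr he
    · rw [Finset.disjoint_left]
      intro e h1 h2
      exact hnd.2.2 (by simpa using h1) (by simpa using h2)
    · intro e he a ha
      have : e ∈ q.edges := by rw [hed]; simp at he ⊢; exact Or.inl he
      simpa using hL e this a ha
    · intro e he a ha
      have : e ∈ q.edges := by rw [hed]; simp at he ⊢; exact Or.inr he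
      simpa using hL e this a ha

/-- First hitting of a set. -/
theorem exists_hit {S : Finset (Sym2 V)} {g s : V} (h : R S g s) {L : Finset V} (hs : s ∈ L) :
    ∃ w ∈ L, R (S.filter (fun e => ∃ a ∈ e, a ∉ L)) g w := by
  rw [R_iff] at h
  induction h using Relation.ReflTransGen.head_induction_on with
  | refl => exact ⟨s, hs, R_refl _ _⟩
  | @head a c hac _ ih =>
    by_cases ha : a ∈ L
    · exact ⟨a, ha, R_refl _ _⟩
    · obtain ⟨w, hw, hr⟩ := ih
      refine ⟨w, hw, R_trans (R_step ?_) hr⟩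
      simp [hac, ha]

/-- Edges not touching `A`. -/
def off (S : Finset (Sym2 V)) (A : Finset V) : Finset (Sym2 V) :=
  S.filter (fun e => ∀ a ∈ e, a ∉ A)

theorem mem_off {S : Finset (Sym2 V)} {A : Finset V} {e : Sym2 V} :
    e ∈ off S A ↔ e ∈ S ∧ ∀ a ∈ e, a ∉ A := by
  unfold off; exact Finset.mem_filter

theorem off_subset (S : Finset (Sym2 V)) (A : Finset V) : off S A ⊆ S := Finset.filter_subset _ _

theorem tree_split {S : Finset (Sym2 V)} {u z g : V} (h1 : R S u z) (h2 : R S u g) :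
    ∃ w, disj (disj (fun S => R S u w) (fun S => R S w z)) (fun S => R S w g) S := by
  obtain ⟨L, hu, hz, -, hL⟩ := exists_path_split h1
  obtain ⟨w, hw, hr⟩ := exists_hit (R_symm h2) hu
  obtain ⟨X, Y, hX, hY, hd, hRX, hRY, hXL, hYL⟩ := hL w hw
  refine ⟨w, X ∪ Y, S.filter (fun e => ∃ a ∈ e, a ∉ L), Finset.union_subset hX hY,
    Finset.filter_subset _ _, ?_, ⟨X, Y, Finset.subset_union_left, Finset.subset_union_right,
    hd, hRX, hRY⟩, R_symm hr⟩
  rw [Finset.disjoint_left]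
  intro e he he'
  obtain ⟨a, ha, haL⟩ := (Finset.mem_filter.1 he').2
  rcases Finset.mem_union.1 he with h | h
  · exact haL (hXL e h a ha)
  · exact haL (hYL e h a ha)

theorem off_split {S : Finset (Sym2 V)} {v g : V} {A : Finset V} (h1 : R S v g)
    (h2 : ¬ R (off S A) v g) :
    ∃ z ∈ A, disj (fun S => R S v z) (fun S => R S z g) S := by
  obtain ⟨L, hu, hz, ⟨X, hXS, hRX, hXL⟩, hL⟩ := exists_path_split h1
  by_cases h : ∃ z ∈ A, z ∈ L
  · obtain ⟨z, hzA, hzL⟩ := h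
    obtain ⟨X, Y, hX, hY, hd, hRX, hRY, -, -⟩ := hL z hzL
    exact ⟨z, hzA, X, Y, hX, hY, hd, hRX, hRY⟩
  · exfalso
    push Not at h
    refine h2 (R_mono ?_ hRX)
    intro e he
    refine Finset.mem_filter.2 ⟨hXS he, fun a ha haA => h a haA (hXL e he a ha)⟩

theorem step_split {S : Finset (Sym2 V)} {x y : V} (h : R S x y) (hxy : x ≠ y) :
    ∃ c, s(x, c) ∈ S ∧ x ≠ c ∧ disj (fun S => s(x, c) ∈ S) (fun S => R S c y) S := by
  obtain ⟨q, hq⟩ := h.exists_isPath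
  cases q with
  | nil => exact absurd rfl hxy
  | @cons _ c _ hadj r =>
    have hadj' := (SimpleGraph.fromEdgeSet_adj _).1 hadj
    have hmem : s(x, c) ∈ S := by exact_mod_cast hadj'.1
    refine ⟨c, hmem, hadj'.2, {s(x, c)}, S.erase s(x, c), by simpa using hmem,
      Finset.erase_subset _ _, by simp, by simp, ?_⟩
    have hnd : s(x, c) ∉ r.edges := by
      have := hq.isTrail.edges_nodup
      simp only [SimpleGraph.Walk.edges_cons, List.nodup_cons] at this
      exact this.1
    have hx : ∀ {a b : V} (r : (SimpleGraph.fromEdgeSet (S : Set (Sym2 V))).Walk a b),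
        s(x, c) ∉ r.edges → R (S.erase s(x, c)) a b := by
      intro a b r
      induction r with
      | nil => intro _; exact R_refl _ _
      | cons h' r ih =>
        intro hn
        simp only [SimpleGraph.Walk.edges_cons, List.mem_cons, not_or] at hn
        refine R_trans (R_step ?_) (ih hn.2)
        have := ((SimpleGraph.fromEdgeSet_adj _).1 h').1
        exact Finset.mem_erase.2 ⟨fun h => hn.1 h.symm, by exact_mod_cast this⟩
    exact hx r hnd

variable [Fintype V]

/-- Cluster. -/
def Cl (S : Finset (Sym2 V)) (x : V) : Finset V := Finset.univ.filter (fun y => R S x y)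

theorem mem_Cl {S : Finset (Sym2 V)} {x y : V} : y ∈ Cl S x ↔ R S x y := by simp [Cl]

theorem self_mem_Cl (S : Finset (Sym2 V)) (x : V) : x ∈ Cl S x := mem_Cl.2 (R_refl _ _)

theorem Cl_mono {S T : Finset (Sym2 V)} (h : S ⊆ T) (x : V) : Cl S x ⊆ Cl T x :=
  fun _ hy => mem_Cl.2 (R_mono h (mem_Cl.1 hy))

theorem Cl_eq {S : Finset (Sym2 V)} {x y : V} (h : R S x y) : Cl S x = Cl S y := by
  ext z; rw [mem_Cl, mem_Cl]
  exact ⟨fun h' => R_trans (R_symm h) h', fun h' => R_trans h h'⟩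

def Closed (S : Finset (Sym2 V)) (A : Finset V) : Prop :=
  ∀ a ∈ A, ∀ b, s(a, b) ∈ S → b ∈ A

theorem Closed_Cl (S : Finset (Sym2 V)) (u : V) : Closed S (Cl S u) :=
  fun _ ha _ hb => mem_Cl.2 (R_trans (mem_Cl.1 ha) (R_step hb))

theorem Closed_union {S : Finset (Sym2 V)} {A B : Finset V} (hA : Closed S A) (hB : Closed S B) :
    Closed S (A ∪ B) := by
  intro a ha b hb
  rcases Finset.mem_union.1 ha with h | h
  · exact Finset.mem_union_left _ (hA a h b hb)
  · exact Finset.mem_union_right _ (hB a h b hb)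

theorem Cl_off {S : Finset (Sym2 V)} {A : Finset V} (hA : Closed S A) {v : V} (hv : v ∉ A) :
    Cl (off S A) v = Cl S v := by
  refine (Cl_mono (off_subset S A) v).antisymm fun y hy => ?_
  have := R_ind (mem_Cl.1 hy) (fun y => y ∉ A ∧ R (off S A) v y) ⟨hv, R_refl _ _⟩ ?_
  · exact mem_Cl.2 this.2
  · rintro b c - ⟨hb, hRb⟩ hbc
    have hc : c ∉ A := fun hc => hb (hA c hc b (by rwa [Sym2.eq_swap]))
    refine ⟨hc, R_trans hRb (R_step ?_)⟩
    refine mem_off.2 ⟨hbc, fun a ha => ?_⟩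
    rcases Sym2.mem_iff.1 ha with rfl | rfl <;> assumption

theorem Cl_det {S T : Finset (Sym2 V)} {A : Finset V}
    (h : ∀ e, (∃ a ∈ e, a ∈ A) → (e ∈ S ↔ e ∈ T)) {u : V} (hS : Cl S u = A) : Cl T u = A := by
  have hu : u ∈ A := hS ▸ self_mem_Cl S u
  apply Finset.Subset.antisymm
  · intro y hy
    refine R_ind (mem_Cl.1 hy) (fun y => y ∈ A) hu ?_
    intro b c _ hb hbc
    have : s(b, c) ∈ S := (h _ ⟨b, by simp, hb⟩).2 hbc
    rw [← hS] at hb ⊢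
    exact Closed_Cl S u b hb c this
  · intro y hy
    rw [← hS] at hy
    rw [mem_Cl]
    refine R_ind (mem_Cl.1 hy) (fun y => R T u y) (R_refl _ _) ?_
    intro b c hb hRb hbc
    have hbA : b ∈ A := hS ▸ mem_Cl.2 hb
    exact R_trans hRb (R_step ((h _ ⟨b, by simp, hbA⟩).1 hbc))

theorem Cl_det_iff {S T : Finset (Sym2 V)} {A : Finset V}
    (h : ∀ e, (∃ a ∈ e, a ∈ A) → (e ∈ S ↔ e ∈ T)) {u : V} : Cl S u = A ↔ Cl T u = A :=
  ⟨Cl_det h, Cl_det fun e he => (h e he).symm⟩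

/-- Triples used in the branching event. -/
structure Tri (T : Finset V) (x : V) (S : Finset (Sym2 V)) (u v v' : V) : Prop where
  hx : R S u x
  hu : Disjoint (Cl S u) T
  hv : ¬ Disjoint (Cl S v) T
  hv' : ¬ Disjoint (Cl S v') T
  huv : v ∉ Cl S u
  huv' : v' ∉ Cl S u
  hvv' : v' ∉ Cl S v

def TT (T : Finset V) (x : V) (S : Finset (Sym2 V)) (u v v' : V) : Prop :=
  s(u, v) ∈ S ∧ s(u, v') ∈ S ∧ Tri T x ((S.erase s(u, v)).erase s(u, v')) u v v'

theorem TT_exit {T : Finset V} {x : V} {S : Finset (Sym2 V)} {u v v' : V} (h : TT T x S u v v')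
    {H : Finset (Sym2 V)} (hH : H ⊆ S) {w g : V}
    (hw : R ((S.erase s(u, v)).erase s(u, v')) u w)
    (hg : ¬ R ((S.erase s(u, v)).erase s(u, v')) u g) (hr : R H w g) : R H w u := by
  obtain ⟨h1, h2, h3⟩ := h
  rw [R_iff] at hr
  induction hr using Relation.ReflTransGen.head_induction_on with
  | refl => exact absurd hw hg
  | @head a c hac _ ih =>
    by_cases hc : R ((S.erase s(u, v)).erase s(u, v')) u c
    · exact R_trans (R_step hac) (ih hc)
    · have hne : s(a, c) ∉ (S.erase s(u, v)).erase s(u, v') :=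
        fun h => hc (R_trans hw (R_step h))
      have haS : s(a, c) ∈ S := hH hac
      have : s(a, c) = s(u, v) ∨ s(a, c) = s(u, v') := by
        simp only [Finset.mem_erase] at hne
        tauto
      have hau : a = u := by
        rcases this with h | h
        · rcases Sym2.eq_iff.1 h with ⟨h, -⟩ | ⟨h, -⟩
          · exact h
          · exact absurd (mem_Cl.2 (h ▸ hw)) h3.huv
        · rcases Sym2.eq_iff.1 h with ⟨h, -⟩ | ⟨h, -⟩
          · exact h
          · exact absurd (mem_Cl.2 (h ▸ hw)) h3.huv'
      rw [hau]; exact R_refl _ _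

theorem not_disj_Cl {S : Finset (Sym2 V)} {v : V} {T : Finset V} (h : ¬ Disjoint (Cl S v) T) :
    ∃ g ∈ T, R S v g := by
  rw [Finset.not_disjoint_iff] at h
  obtain ⟨g, hg, hT⟩ := h
  exact ⟨g, hT, mem_Cl.1 hg⟩

theorem disj_Cl {S : Finset (Sym2 V)} {v : V} {T : Finset V} (h : Disjoint (Cl S v) T) {g : V}
    (hg : g ∈ T) : ¬ R S v g :=
  fun h' => Finset.disjoint_left.1 h (mem_Cl.2 h') hg

theorem erase2_subset (S : Finset (Sym2 V)) (e f : Sym2 V) : (S.erase e).erase f ⊆ S :=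
  (Finset.erase_subset _ _).trans (Finset.erase_subset _ _)

theorem TT_swap {T : Finset V} {x : V} {S : Finset (Sym2 V)} {u v v' : V} (h : TT T x S u v v') :
    TT T x S u v' v := by
  obtain ⟨h1, h2, h3⟩ := h
  refine ⟨h2, h1, ?_⟩
  rw [Finset.erase_right_comm] at h3
  exact ⟨h3.hx, h3.hu, h3.hv', h3.hv, h3.huv', h3.huv,
    fun h => h3.hvv' (mem_Cl.2 (R_symm (mem_Cl.1 h)))⟩

/-- If the second apex is in the first region then the bond end is not in the region. -/
theorem TT_aux {T : Finset V} {x : V} {S : Finset (Sym2 V)} {u v v' u₂ w w' : V}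
    (h : TT T x S u v v') (h' : TT T x S u₂ w w')
    (hw : R ((S.erase s(u, v)).erase s(u, v')) u w) :
    R ((S.erase s(u₂, w)).erase s(u₂, w')) w u := by
  obtain ⟨g, hg, hr⟩ := not_disj_Cl h'.2.2.hv
  exact TT_exit h (erase2_subset _ _ _) hw (disj_Cl h.2.2.hu hg) hr

theorem TT_apex1 {T : Finset V} {x : V} {S : Finset (Sym2 V)} {u v v' u₂ w w' : V}
    (h : TT T x S u v v') (h' : TT T x S u₂ w w')
    (hu2 : R ((S.erase s(u, v)).erase s(u, v')) u u₂) : u = u₂ := by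
  by_contra hne
  have key : ∀ c, s(u₂, c) ∈ S → R ((S.erase s(u, v)).erase s(u, v')) u c := by
    intro c hc
    refine R_trans hu2 (R_step ?_)
    refine Finset.mem_erase.2 ⟨fun h1 => ?_, Finset.mem_erase.2 ⟨fun h1 => ?_, hc⟩⟩
    · rcases Sym2.eq_iff.1 h1 with ⟨h2, -⟩ | ⟨h2, -⟩
      · exact hne h2.symm
      · exact h.2.2.huv' (mem_Cl.2 (h2 ▸ hu2))
    · rcases Sym2.eq_iff.1 h1 with ⟨h2, -⟩ | ⟨h2, -⟩
      · exact hne h2.symm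
      · exact h.2.2.huv (mem_Cl.2 (h2 ▸ hu2))
  have r1 := TT_aux h h' (key w h'.1)
  have r2 := TT_aux h (TT_swap h') (key w' h'.2.1)
  rw [Finset.erase_right_comm] at r2
  exact h'.2.2.hvv' (mem_Cl.2 (R_trans r1 (R_symm r2)))

theorem TT_apex {T : Finset V} {x : V} {S : Finset (Sym2 V)} {u v v' u₂ w w' : V}
    (h : TT T x S u v v') (h' : TT T x S u₂ w w') : u = u₂ := by
  by_cases h1 : R ((S.erase s(u₂, w)).erase s(u₂, w')) u₂ u
  · exact (TT_apex1 h' h h1).symm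
  · have := TT_exit h' (erase2_subset S s(u, v) s(u, v')) h'.2.2.hx h1 (R_symm h.2.2.hx)
    exact TT_apex1 h h' (R_trans h.2.2.hx this)

theorem TT_end {T : Finset V} {x : V} {S : Finset (Sym2 V)} {u v v' w w' : V}
    (h : TT T x S u v v') (h' : TT T x S u w w') : w = v ∨ w = v' := by
  by_contra hne
  push Not at hne
  have hw : R ((S.erase s(u, v)).erase s(u, v')) u w := by
    refine R_step (Finset.mem_erase.2 ⟨fun h1 => ?_, Finset.mem_erase.2 ⟨fun h1 => ?_, h'.1⟩⟩)
    · exact hne.2 (Sym2.congr_right.1 h1)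
    · exact hne.1 (Sym2.congr_right.1 h1)
  have := TT_aux h h' hw
  exact h'.2.2.huv (mem_Cl.2 (R_symm this))

theorem TT_hit {T : Finset V} {x : V} {S : Finset (Sym2 V)} {u v v' : V}
    (h : TT T x S u v v') : ¬ Disjoint (Cl S x) T := by
  obtain ⟨g, hg, hr⟩ := not_disj_Cl h.2.2.hv
  rw [Finset.not_disjoint_iff]
  refine ⟨g, mem_Cl.2 ?_, hg⟩
  have hsub := erase2_subset S s(u, v) s(u, v')
  exact R_trans (R_symm (R_mono hsub h.2.2.hx)) (R_trans (R_step h.1) (R_mono hsub hr))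

theorem TT_ne {T : Finset V} {x : V} {S : Finset (Sym2 V)} {u v v' : V}
    (h : TT T x S u v v') : v ≠ v' := by
  rintro rfl
  exact h.2.2.hvv' (self_mem_Cl _ _)

theorem TT_sum (T : Finset V) (x : V) (S : Finset (Sym2 V)) :
    ∑ u : V, ∑ v : V, ∑ v' : V, ind (TT T x S u v v') ≤ 2 * ind (¬ Disjoint (Cl S x) T) := by
  by_cases hex : ∃ u v v', TT T x S u v v'
  · obtain ⟨u, v, v', h⟩ := hex
    rw [ind_true (TT_hit h)]
    have hb : ∀ a b c, ind (TT T x S a b c) ≤ ind ((a, b, c) = (u, v, v')) +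
        ind ((a, b, c) = (u, v', v)) := by
      intro a b c
      by_cases h' : TT T x S a b c
      · obtain rfl := TT_apex h h'
        have hne := TT_ne h'
        have h1 := TT_end h h'
        have h2 := TT_end h (TT_swap h')
        rw [ind_true h']
        have : (u, b, c) = (u, v, v') ∨ (u, b, c) = (u, v', v) := by
          rcases h1 with rfl | rfl <;> rcases h2 with rfl | rfl <;> simp_all
        rcases this with h | h
        · rw [ind_true h]; linarith [ind_nonneg ((u, b, c) = (u, v', v))]
        · rw [ind_true h]; linarith [ind_nonneg ((u, b, c) = (u, v, v'))]
      · rw [ind_false h']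
        exact add_nonneg (ind_nonneg _) (ind_nonneg _)
    have hs : ∀ t : V × V × V, ∑ a : V, ∑ b : V, ∑ c : V, ind ((a, b, c) = t) = 1 := by
      rintro t
      have : ∑ a : V, ∑ b : V, ∑ c : V, ind ((a, b, c) = t) = ∑ r : V × V × V, ind (r = t) := by
        rw [Fintype.sum_prod_type]
        refine Finset.sum_congr rfl fun a _ => ?_
        rw [Fintype.sum_prod_type]
      rw [this, Finset.sum_eq_single t]
      · exact ind_true rfl
      · intro b _ hb; exact ind_false hb
      · intro h; exact absurd (Finset.mem_univ _) h
    calc _ ≤ ∑ a : V, ∑ b : V, ∑ c : V, (ind ((a, b, c) = (u, v, v')) +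
        ind ((a, b, c) = (u, v', v))) :=
          Finset.sum_le_sum fun a _ => Finset.sum_le_sum fun b _ => Finset.sum_le_sum fun c _ =>
            hb a b c
      _ = _ := by
        simp_rw [Finset.sum_add_distrib]
        rw [hs, hs]; norm_num
  · push Not at hex
    rw [Finset.sum_eq_zero]
    · have := ind_nonneg (¬ Disjoint (Cl S x) T); linarith
    · intro u _
      refine Finset.sum_eq_zero fun v _ => Finset.sum_eq_zero fun v' _ => ind_false (hex u v v')

end graph

section percolation
variable {V : Type*} [Fintype V] {E : Finset (Sym2 V)} {p : ℝ}

/-- Two-point function. -/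
def tau2 (E : Finset (Sym2 V)) (p : ℝ) (x y : V) : ℝ := Ex E p (fun S => ind (R S x y))

/-- Triangle. -/
def tri2 (E : Finset (Sym2 V)) (p : ℝ) (x y : V) : ℝ :=
  ∑ u : V, ∑ v : V, tau2 E p x u * tau2 E p u v * tau2 E p v y

/-- Probability that a set is hit by the ghost field. -/
def bq (q : ℝ) (C : Finset V) : ℝ := 1 - q ^ C.card

/-- Weight of the unhit cluster. -/
def aq (q : ℝ) (C : Finset V) : ℝ := (C.card : ℝ) * q ^ C.card

theorem tau2_symm (x y : V) : tau2 E p x y = tau2 E p y x :=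
  Ex_congr fun _ _ => ind_congr R_comm

theorem tau2_nonneg (hp0 : 0 ≤ p) (hp1 : p ≤ 1) (x y : V) : 0 ≤ tau2 E p x y :=
  Ex_nonneg hp0 hp1 fun _ _ => ind_nonneg _

theorem tau2_self (x : V) : tau2 E p x x = 1 := by
  unfold tau2
  rw [← Ex_const (E := E) (p := p) 1]
  exact Ex_congr fun S _ => ind_true (R_refl _ _)

theorem bq_nonneg {q : ℝ} (h0 : 0 ≤ q) (h1 : q ≤ 1) (C : Finset V) : 0 ≤ bq q C := by
  unfold bq
  linarith [pow_le_one₀ h0 h1 (n := C.card)]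

theorem bq_mono {q : ℝ} (h0 : 0 ≤ q) (h1 : q ≤ 1) {C D : Finset V} (h : C ⊆ D) :
    bq q C ≤ bq q D := by
  unfold bq
  linarith [pow_le_pow_of_le_one h0 h1 (Finset.card_le_card h)]

theorem aq_nonneg {q : ℝ} (h0 : 0 ≤ q) (C : Finset V) : 0 ≤ aq q C := by
  unfold aq; positivity

theorem aq_le {q : ℝ} (h0 : 0 ≤ q) (h1 : q ≤ 1) (C : Finset V) : (1 - q) * aq q C ≤ bq q C := by
  unfold aq bq
  generalize C.card = n
  induction n with
  | zero => simp
  | succ n ih =>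
    have hq : 0 ≤ q ^ n := by positivity
    have hq1 : q ^ (n + 1) ≤ q ^ n := pow_le_pow_of_le_one h0 h1 (Nat.le_succ n)
    have h2 : q ^ (n + 1) = q * q ^ n := by ring
    have hn : (0 : ℝ) ≤ n := Nat.cast_nonneg n
    push_cast
    have e1 : (1 - q) * ((n : ℝ) * q ^ (n + 1)) ≤ (1 - q) * ((n : ℝ) * q ^ n) := by
      have : 0 ≤ 1 - q := by linarith
      gcongr
    have e2 : (1 - q) * q ^ (n + 1) ≤ (1 - q) * q ^ n := by
      have : 0 ≤ 1 - q := by linarith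
      gcongr
    nlinarith

theorem avg_disjoint (q : ℝ) (C : Finset V) :
    Ex Finset.univ (1 - q) (fun T => ind (Disjoint C T)) = q ^ C.card := by
  rw [Ex_disjoint]; simp

theorem avg_hit (q : ℝ) (C : Finset V) :
    Ex Finset.univ (1 - q) (fun T => ind (¬ Disjoint C T)) = bq q C := by
  simp_rw [ind_not]
  rw [Ex_sub, Ex_const, avg_disjoint, bq]

theorem avg_three (q : ℝ) {A B D : Finset V} (hAB : Disjoint A B) (hAD : Disjoint A D)
    (hBD : Disjoint B D) :
    Ex Finset.univ (1 - q) (fun T => ind (Disjoint A T) * (ind (¬ Disjoint B T) *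
      ind (¬ Disjoint D T))) = q ^ A.card * (bq q B * bq q D) := by
  have hdet : ∀ C : Finset V, ∀ S T : Finset V, (∀ e, e ∈ C → (e ∈ S ↔ e ∈ T)) →
      (Disjoint C S ↔ Disjoint C T) := by
    intro C S T h
    rw [Finset.disjoint_left, Finset.disjoint_left]
    exact ⟨fun h' a ha => by rw [← h a ha]; exact h' ha, fun h' a ha => by rw [h a ha]; exact h' ha⟩
  rw [Ex_indep (fun e => e ∈ A), avg_disjoint, Ex_indep (fun e => e ∈ B), avg_hit, avg_hit]
  · intro S T h; exact ind_congr (not_congr (hdet B S T h))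
  · intro S T h
    exact ind_congr (not_congr (hdet D S T fun e he => h e fun h' =>
      Finset.disjoint_left.1 hBD h' he))
  · intro S T h; exact ind_congr (hdet A S T h)
  · intro S T h
    rw [ind_congr (not_congr (hdet B S T fun e he => h e fun h' =>
      Finset.disjoint_left.1 hAB h' he)), ind_congr (not_congr (hdet D S T fun e he => h e fun h' =>
      Finset.disjoint_left.1 hAD h' he))]

theorem hit_inc (w : V) (T : Finset V) : Inc (fun S : Finset (Sym2 V) => ¬ Disjoint (Cl S w) T) :=
  fun _ _ h h1 h2 => h1 (h2.mono_left (Cl_mono h w))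

theorem disj_imp {α : Type*} {A B A' B' : Finset α → Prop} (hA : ∀ S, A S → A' S)
    (hB : ∀ S, B S → B' S) {S : Finset α} (h : disj A B S) : disj A' B' S := by
  obtain ⟨X, Y, h1, h2, h3, h4, h5⟩ := h
  exact ⟨X, Y, h1, h2, h3, hA _ h4, hB _ h5⟩

theorem ind_le_sum {ι : Type*} (s : Finset ι) (Q : ι → Prop) {P : Prop}
    (h : P → ∃ i ∈ s, Q i) : ind P ≤ ∑ i ∈ s, ind (Q i) := by
  by_cases hP : P
  · obtain ⟨i, hi, hQ⟩ := h hP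
    rw [ind_true hP, ← ind_true hQ]
    exact Finset.single_le_sum (f := fun i => ind (Q i)) (fun i _ => ind_nonneg _) hi
  · rw [ind_false hP]
    exact Finset.sum_nonneg fun i _ => ind_nonneg _

/-- Tree graph bound. -/
theorem bk_tree (hp0 : 0 ≤ p) (hp1 : p ≤ 1 / 2) {q m : ℝ} (hq0 : 0 ≤ q) (hq1 : q ≤ 1)
    (hM : ∀ x, Ex E p (fun S => bq q (Cl S x)) = m) (u z : V) :
    Ex E p (fun S => ind (R S u z) * bq q (Cl S u)) ≤
      ∑ w : V, tau2 E p u w * tau2 E p w z * m := by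
  have hp1' : p ≤ 1 := by linarith
  have h1 : Ex E p (fun S => ind (R S u z) * bq q (Cl S u)) =
      Ex Finset.univ (1 - q) (fun T => Ex E p (fun S => ind (R S u z) *
        ind (¬ Disjoint (Cl S u) T))) := by
    rw [← Ex_comm]
    refine Ex_congr fun S _ => ?_
    rw [Ex_mul_left, avg_hit]
  have h2 : ∑ w : V, tau2 E p u w * tau2 E p w z * m =
      Ex Finset.univ (1 - q) (fun T => ∑ w : V, tau2 E p u w * tau2 E p w z *
        Ex E p (fun S => ind (¬ Disjoint (Cl S w) T))) := by
    rw [Ex_sum]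
    refine Finset.sum_congr rfl fun w _ => ?_
    rw [Ex_mul_left, ← Ex_comm, ← hM w]
    congr 1
    exact Ex_congr fun S _ => (avg_hit _ _).symm
  rw [h1, h2]
  refine Ex_mono (by linarith) (by linarith) fun T _ => ?_
  calc Ex E p (fun S => ind (R S u z) * ind (¬ Disjoint (Cl S u) T))
      ≤ Ex E p (fun S => ∑ w : V, ind (disj (disj (fun S => R S u w) (fun S => R S w z))
          (fun S => ¬ Disjoint (Cl S w) T) S)) := by
        refine Ex_mono hp0 hp1' fun S _ => ?_
        rw [← ind_and]
        refine ind_le_sum _ _ ?_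
        rintro ⟨ha, hb⟩
        obtain ⟨g, hg, hr⟩ := not_disj_Cl hb
        obtain ⟨w, hw⟩ := tree_split ha hr
        refine ⟨w, Finset.mem_univ _, disj_imp (fun _ h => h) (fun S h => ?_) hw⟩
        exact Finset.not_disjoint_iff.2 ⟨g, mem_Cl.2 h, hg⟩
    _ = ∑ w : V, Ex E p (fun S => ind (disj (disj (fun S => R S u w) (fun S => R S w z))
          (fun S => ¬ Disjoint (Cl S w) T) S)) := Ex_sum _ _
    _ ≤ _ := by
        refine Finset.sum_le_sum fun w _ => ?_
        refine (BK hp0 hp1 disj_inc (hit_inc w T)).trans ?_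
        refine mul_le_mul_of_nonneg_right (BK hp0 hp1 (R_inc u w) (R_inc w z)) ?_
        exact Ex_nonneg hp0 hp1' fun _ _ => ind_nonneg _

theorem bk_off (hp0 : 0 ≤ p) (hp1 : p ≤ 1 / 2) {q m : ℝ} (hq0 : 0 ≤ q) (hq1 : q ≤ 1)
    (hM : ∀ x, Ex E p (fun S => bq q (Cl S x)) = m) (v : V) (A : Finset V) :
    m * (1 - ∑ z ∈ A, tau2 E p v z) ≤ Ex E p (fun S => bq q (Cl (off S A) v)) := by
  have hp1' : p ≤ 1 := by linarith
  have h1 : Ex E p (fun S => bq q (Cl (off S A) v)) =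
      Ex Finset.univ (1 - q) (fun T => Ex E p (fun S => ind (¬ Disjoint (Cl (off S A) v) T))) := by
    rw [← Ex_comm]
    exact Ex_congr fun S _ => (avg_hit _ _).symm
  have h2 : ∀ x, m =
      Ex Finset.univ (1 - q) (fun T => Ex E p (fun S => ind (¬ Disjoint (Cl S x) T))) := by
    intro x
    rw [← hM x, ← Ex_comm]
    exact Ex_congr fun S _ => (avg_hit _ _).symm
  have h3 : m * ∑ z ∈ A, tau2 E p v z = Ex Finset.univ (1 - q) (fun T => ∑ z ∈ A, tau2 E p v z *
        Ex E p (fun S => ind (¬ Disjoint (Cl S z) T))) := by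
    rw [Ex_sum, mul_comm, Finset.sum_mul]
    refine Finset.sum_congr rfl fun w _ => ?_
    rw [Ex_mul_left, ← h2 w]
  rw [mul_sub, mul_one, h3, h1]
  nth_rewrite 1 [h2 v]
  rw [← Ex_sub]
  refine Ex_mono (by linarith) (by linarith) fun T _ => ?_
  rw [sub_le_iff_le_add]
  calc Ex E p (fun S => ind (¬ Disjoint (Cl S v) T))
      ≤ Ex E p (fun S => ind (¬ Disjoint (Cl (off S A) v) T) + ∑ z ∈ A,
          ind (disj (fun S => R S v z) (fun S => ¬ Disjoint (Cl S z) T) S)) := by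
        refine Ex_mono hp0 hp1' fun S _ => ?_
        have hn : 0 ≤ ∑ z ∈ A,
          ind (disj (fun S => R S v z) (fun S => ¬ Disjoint (Cl S z) T) S) :=
            Finset.sum_nonneg fun i _ => ind_nonneg _
        by_cases hoff : ¬ Disjoint (Cl (off S A) v) T
        · rw [ind_true hoff]
          linarith [ind_le_one (¬ Disjoint (Cl S v) T)]
        · rw [ind_false hoff, zero_add]
          refine ind_le_sum _ _ fun h => ?_
          obtain ⟨g, hg, hr⟩ := not_disj_Cl h
          rw [not_not] at hoff
          obtain ⟨z, hz, hd⟩ := off_split hr (disj_Cl hoff hg)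
          refine ⟨z, hz, disj_imp (fun _ h => h) (fun S h => ?_) hd⟩
          exact Finset.not_disjoint_iff.2 ⟨g, mem_Cl.2 h, hg⟩
    _ = Ex E p (fun S => ind (¬ Disjoint (Cl (off S A) v) T)) + ∑ z ∈ A, Ex E p (fun S =>
          ind (disj (fun S => R S v z) (fun S => ¬ Disjoint (Cl S z) T) S)) := by
        rw [Ex_add, Ex_sum]
    _ ≤ _ := by
        gcongr with z hz
        exact BK hp0 hp1 (R_inc v z) (hit_inc z T)

section cond
variable {ι : Type*} [Fintype ι] {Y : Finset (Sym2 V) → ι} {reg : ι → Finset V}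

theorem Ex_class (F : ι → ℝ) :
    Ex E p (fun S => F (Y S)) = ∑ i, F i * Ex E p (fun S => ind (Y S = i)) := by
  simp_rw [← Ex_mul_left]
  rw [← Ex_sum]
  refine Ex_congr fun S _ => ?_
  rw [Finset.sum_eq_single (Y S)]
  · rw [ind_true rfl, mul_one]
  · intro i _ hi; rw [ind_false (Ne.symm hi), mul_zero]
  · intro h; exact absurd (Finset.mem_univ _) h

theorem cond_eq
    (hdet : ∀ i (S T : Finset (Sym2 V)), (∀ e, (∃ a ∈ e, a ∈ reg i) → (e ∈ S ↔ e ∈ T)) →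
      Y S = i → Y T = i)
    (hcl : ∀ S, Closed S (reg (Y S))) (F : ι → ℝ) (h : Finset V → ℝ) (v : V) :
    Ex E p (fun S => F (Y S) * (ind (v ∉ reg (Y S)) * h (Cl S v))) =
      ∑ i, F i * (ind (v ∉ reg i) * (Ex E p (fun S => ind (Y S = i)) *
        Ex E p (fun S => h (Cl (off S (reg i)) v)))) := by
  have h1 : ∀ i, Ex E p (fun S => ind (Y S = i)) * Ex E p (fun S => h (Cl (off S (reg i)) v)) =
      Ex E p (fun S => ind (Y S = i) * h (Cl (off S (reg i)) v)) := by
    intro i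
    rw [Ex_indep (fun e => ∃ a ∈ e, a ∈ reg i)]
    · intro S T hST
      exact ind_congr ⟨hdet i S T hST, hdet i T S fun e he => (hST e he).symm⟩
    · intro S T hST
      have : off S (reg i) = off T (reg i) := by
        ext e
        rw [mem_off, mem_off]
        constructor
        · rintro ⟨h1, h2⟩
          exact ⟨(hST e (by push Not; exact h2)).1 h1, h2⟩
        · rintro ⟨h1, h2⟩
          exact ⟨(hST e (by push Not; exact h2)).2 h1, h2⟩
      rw [this]
  simp_rw [h1, ← Ex_mul_left]
  rw [← Ex_sum]
  refine Ex_congr fun S _ => ?_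
  rw [Finset.sum_eq_single (Y S)]
  · rw [ind_true rfl, one_mul]
    by_cases hv : v ∈ reg (Y S)
    · rw [ind_false (not_not.2 hv)]; ring
    · rw [Cl_off (hcl S) hv]
  · intro i _ hi; rw [ind_false (Ne.symm hi)]; ring
  · intro h; exact absurd (Finset.mem_univ _) h

theorem cond_le (hp0 : 0 ≤ p) (hp1 : p ≤ 1)
    (hdet : ∀ i (S T : Finset (Sym2 V)), (∀ e, (∃ a ∈ e, a ∈ reg i) → (e ∈ S ↔ e ∈ T)) →
      Y S = i → Y T = i)
    (hcl : ∀ S, Closed S (reg (Y S))) (F : ι → ℝ) (hF : ∀ i, 0 ≤ F i) (h : Finset V → ℝ)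
    (h0 : ∀ C, 0 ≤ h C) (hm : ∀ C D, C ⊆ D → h C ≤ h D) (v : V) :
    Ex E p (fun S => F (Y S) * (ind (v ∉ reg (Y S)) * h (Cl S v))) ≤
      Ex E p (fun S => F (Y S)) * Ex E p (fun S => h (Cl S v)) := by
  rw [cond_eq hdet hcl, Ex_class, Finset.sum_mul]
  refine Finset.sum_le_sum fun i _ => ?_
  rw [mul_assoc]
  refine mul_le_mul_of_nonneg_left ?_ (hF i)
  have hnn : 0 ≤ Ex E p (fun S => ind (Y S = i)) := Ex_nonneg hp0 hp1 fun _ _ => ind_nonneg _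
  have hle : Ex E p (fun S => h (Cl (off S (reg i)) v)) ≤ Ex E p (fun S => h (Cl S v)) :=
    Ex_mono hp0 hp1 fun S _ => hm _ _ (Cl_mono (off_subset _ _) v)
  have hnn2 : 0 ≤ Ex E p (fun S => ind (Y S = i)) * Ex E p (fun S => h (Cl (off S (reg i)) v)) :=
    mul_nonneg hnn (Ex_nonneg hp0 hp1 fun _ _ => h0 _)
  calc _ ≤ 1 * (Ex E p (fun S => ind (Y S = i)) * Ex E p (fun S => h (Cl (off S (reg i)) v))) :=
        mul_le_mul_of_nonneg_right (ind_le_one _) hnn2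
    _ ≤ _ := by rw [one_mul]; exact mul_le_mul_of_nonneg_left hle hnn

theorem cond_ge (hp0 : 0 ≤ p) (hp1 : p ≤ 1 / 2) {q m : ℝ} (hq0 : 0 ≤ q) (hq1 : q ≤ 1)
    (hM : ∀ x, Ex E p (fun S => bq q (Cl S x)) = m)
    (hdet : ∀ i (S T : Finset (Sym2 V)), (∀ e, (∃ a ∈ e, a ∈ reg i) → (e ∈ S ↔ e ∈ T)) →
      Y S = i → Y T = i)
    (hcl : ∀ S, Closed S (reg (Y S))) (F : ι → ℝ) (hF : ∀ i, 0 ≤ F i) (v : V) :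
    m * Ex E p (fun S => F (Y S) * (1 - ∑ z ∈ reg (Y S), tau2 E p v z)) ≤
    Ex E p (fun S => F (Y S) * (ind (v ∉ reg (Y S)) * bq q (Cl S v))) := by
  have hp1' : p ≤ 1 := by linarith
  have hm : 0 ≤ m := by
    rw [← hM v]; exact Ex_nonneg hp0 hp1' fun _ _ => bq_nonneg hq0 hq1 _
  rw [cond_eq hdet hcl, Ex_class (fun i => F i * (1 - ∑ z ∈ reg i, tau2 E p v z)), Finset.mul_sum]
  refine Finset.sum_le_sum fun i _ => ?_
  have hnn : 0 ≤ Ex E p (fun S => ind (Y S = i)) := Ex_nonneg hp0 hp1' fun _ _ => ind_nonneg _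
  have key : m * (1 - ∑ z ∈ reg i, tau2 E p v z) ≤ ind (v ∉ reg i) *
      Ex E p (fun S => bq q (Cl (off S (reg i)) v)) := by
    by_cases hv : v ∈ reg i
    · rw [ind_false (not_not.2 hv), zero_mul]
      have : 1 ≤ ∑ z ∈ reg i, tau2 E p v z := by
        rw [← tau2_self (E := E) (p := p) v]
        exact Finset.single_le_sum (f := fun z => tau2 E p v z)
          (fun z _ => tau2_nonneg hp0 hp1' v z) hv
      nlinarith
    · rw [ind_true hv, one_mul]
      exact bk_off hp0 hp1 hq0 hq1 hM v _
  have := mul_le_mul_of_nonneg_left key (mul_nonneg (hF i) hnn)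
  linarith

end cond

end percolation

section diffineq
variable {V : Type*} [Fintype V] {E : Finset (Sym2 V)} {p : ℝ}

/-- Sum of two-point functions over a set. -/
def sq (E : Finset (Sym2 V)) (p : ℝ) (y : V) (A : Finset V) : ℝ := ∑ z ∈ A, tau2 E p y z

theorem sq_nonneg' (hp0 : 0 ≤ p) (hp1 : p ≤ 1) (y : V) (A : Finset V) : 0 ≤ sq E p y A :=
  Finset.sum_nonneg fun z _ => tau2_nonneg hp0 hp1 y z

theorem sq_mono (hp0 : 0 ≤ p) (hp1 : p ≤ 1) (y : V) {A B : Finset V} (h : A ⊆ B) :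
    sq E p y A ≤ sq E p y B :=
  Finset.sum_le_sum_of_subset_of_nonneg h fun z _ _ => tau2_nonneg hp0 hp1 y z

theorem sq_union (hp0 : 0 ≤ p) (hp1 : p ≤ 1) (y : V) (A B : Finset V) :
    sq E p y (A ∪ B) ≤ sq E p y A + sq E p y B := by
  unfold sq
  rw [← Finset.sum_union_inter]
  have : 0 ≤ ∑ z ∈ A ∩ B, tau2 E p y z := Finset.sum_nonneg fun z _ => tau2_nonneg hp0 hp1 y z
  linarith

theorem sq_Cl (y x : V) (S : Finset (Sym2 V)) :
    sq E p y (Cl S x) = ∑ z : V, tau2 E p y z * ind (R S x z) := by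
  unfold sq Cl ind
  rw [Finset.sum_filter]
  exact Finset.sum_congr rfl fun z _ => by split_ifs <;> simp

theorem bq_sq (hp0 : 0 ≤ p) (hp1 : p ≤ 1 / 2) {q m : ℝ} (hq0 : 0 ≤ q) (hq1 : q ≤ 1)
    (hM : ∀ x, Ex E p (fun S => bq q (Cl S x)) = m) (x y : V) :
    Ex E p (fun S => bq q (Cl S x) * sq E p y (Cl S x)) ≤ m * tri2 E p x y := by
  have hp1' : p ≤ 1 := by linarith
  calc Ex E p (fun S => bq q (Cl S x) * sq E p y (Cl S x))
      = Ex E p (fun S => ∑ z : V, tau2 E p y z * (ind (R S x z) * bq q (Cl S x))) := by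
        refine Ex_congr fun S _ => ?_
        rw [sq_Cl, Finset.mul_sum]
        exact Finset.sum_congr rfl fun z _ => by ring
    _ = ∑ z : V, tau2 E p y z * Ex E p (fun S => ind (R S x z) * bq q (Cl S x)) := by
        rw [Ex_sum]
        exact Finset.sum_congr rfl fun z _ => Ex_mul_left _ _
    _ ≤ ∑ z : V, tau2 E p y z * ∑ w : V, tau2 E p x w * tau2 E p w z * m := by
        refine Finset.sum_le_sum fun z _ => ?_
        exact mul_le_mul_of_nonneg_left (bk_tree hp0 hp1 hq0 hq1 hM x z)
          (tau2_nonneg hp0 hp1' _ _)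
    _ = m * tri2 E p x y := by
        unfold tri2
        rw [Finset.mul_sum]
        simp_rw [Finset.mul_sum]
        rw [Finset.sum_comm]
        refine Finset.sum_congr rfl fun u _ => Finset.sum_congr rfl fun v _ => ?_
        rw [tau2_symm y v]; ring

theorem aq_sq (hp0 : 0 ≤ p) (hp1 : p ≤ 1 / 2) {q m : ℝ} (hq0 : 0 ≤ q) (hq1 : q ≤ 1)
    (hM : ∀ x, Ex E p (fun S => bq q (Cl S x)) = m) (x y : V) :
    (1 - q) * Ex E p (fun S => aq q (Cl S x) * sq E p y (Cl S x)) ≤ m * tri2 E p x y := by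
  have hp1' : p ≤ 1 := by linarith
  refine le_trans ?_ (bq_sq hp0 hp1 hq0 hq1 hM x y)
  rw [← Ex_mul_left]
  refine Ex_mono hp0 hp1' fun S _ => ?_
  rw [← mul_assoc]
  exact mul_le_mul_of_nonneg_right (aq_le hq0 hq1 _) (sq_nonneg' hp0 hp1' _ _)

theorem hdet1 (u : V) : ∀ i (S T : Finset (Sym2 V)),
    (∀ e, (∃ a ∈ e, a ∈ id i) → (e ∈ S ↔ e ∈ T)) → Cl S u = i → Cl T u = i :=
  fun _ _ _ h h' => Cl_det h h'

theorem hdet2 (u v : V) : ∀ (i : Finset V × Finset V) (S T : Finset (Sym2 V)),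
    (∀ e, (∃ a ∈ e, a ∈ i.1 ∪ i.2) → (e ∈ S ↔ e ∈ T)) →
    (Cl S u, Cl S v) = i → (Cl T u, Cl T v) = i := by
  rintro ⟨A, B⟩ S T h h'
  rw [Prod.mk.injEq] at h' ⊢
  refine ⟨Cl_det (fun e he => h e ?_) h'.1, Cl_det (fun e he => h e ?_) h'.2⟩
  · obtain ⟨a, h1, h2⟩ := he; exact ⟨a, h1, Finset.mem_union_left _ h2⟩
  · obtain ⟨a, h1, h2⟩ := he; exact ⟨a, h1, Finset.mem_union_right _ h2⟩

/-- The three-cluster expectation. -/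
def Tq (E : Finset (Sym2 V)) (p q : ℝ) (u v v' : V) : ℝ :=
  Ex E p (fun S => aq q (Cl S u) * (ind (v ∉ Cl S u) * bq q (Cl S v)) *
    (ind (v' ∉ Cl S u ∪ Cl S v) * bq q (Cl S v')))

theorem Tq_lower (hp0 : 0 ≤ p) (hp1 : p ≤ 1 / 2) {q m α a : ℝ} (hq0 : 0 ≤ q) (hq1 : q < 1)
    (hM : ∀ x, Ex E p (fun S => bq q (Cl S x)) = m)
    (hα : ∀ x, Ex E p (fun S => aq q (Cl S x)) = α)
    (htri : ∀ x y, x ≠ y → tri2 E p x y ≤ a) {u v v' : V} (huv : u ≠ v) (huv' : u ≠ v')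
    (hvv' : v ≠ v') :
    m ^ 2 * (α * (1 - a) - 2 * a * m / (1 - q)) ≤ Tq E p q u v v' := by
  have hp1' : p ≤ 1 := by linarith
  have hq1' := hq1.le
  have hγ : 0 < 1 - q := by linarith
  have hm : 0 ≤ m := by
    rw [← hM u]; exact Ex_nonneg hp0 hp1' fun _ _ => bq_nonneg hq0 hq1' _
  have hα0 : 0 ≤ α := by
    rw [← hα u]; exact Ex_nonneg hp0 hp1' fun _ _ => aq_nonneg hq0 _
  -- the first estimate
  have s1 := cond_ge (reg := fun i : Finset V × Finset V => i.1 ∪ i.2) hp0 hp1 hq0 hq1' hM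
    (hdet2 u v) (fun S => Closed_union (Closed_Cl S u) (Closed_Cl S v))
    (fun i => aq q i.1 * (ind (v ∉ i.1) * bq q i.2))
    (fun i => mul_nonneg (aq_nonneg hq0 _) (mul_nonneg (ind_nonneg _) (bq_nonneg hq0 hq1' _))) v'
  have s2 := cond_ge (reg := id) hp0 hp1 hq0 hq1' hM (hdet1 u) (fun S => Closed_Cl S u)
    (fun i => aq q i) (fun i => aq_nonneg hq0 _) v
  have s3 := cond_le (E := E) (reg := id) hp0 hp1' (hdet1 u) (fun S => Closed_Cl S u)
    (fun i => aq q i * sq E p v' i)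
    (fun i => mul_nonneg (aq_nonneg hq0 _) (sq_nonneg' hp0 hp1' _ _)) (bq q)
    (bq_nonneg hq0 hq1') (fun C D h => bq_mono hq0 hq1' h) v
  have s4 := cond_le (E := E) (reg := id) hp0 hp1' (hdet1 u) (fun S => Closed_Cl S u)
    (fun i => aq q i) (fun i => aq_nonneg hq0 _) (fun C => bq q C * sq E p v' C)
    (fun C => mul_nonneg (bq_nonneg hq0 hq1' _) (sq_nonneg' hp0 hp1' _ _))
    (fun C D h => mul_le_mul (bq_mono hq0 hq1' h) (sq_mono hp0 hp1' _ h)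
      (sq_nonneg' hp0 hp1' _ _) (bq_nonneg hq0 hq1' _)) v
  have t1 := aq_sq hp0 hp1 hq0 hq1' hM u v
  have t2 := aq_sq hp0 hp1 hq0 hq1' hM u v'
  have t3 := bq_sq hp0 hp1 hq0 hq1' hM v v'
  have t1' := t1.trans (mul_le_mul_of_nonneg_left (htri u v huv) hm)
  have t2' := t2.trans (mul_le_mul_of_nonneg_left (htri u v' huv') hm)
  have t3' := t3.trans (mul_le_mul_of_nonneg_left (htri v v' hvv') hm)
  rw [mul_comm, ← le_div_iff₀ hγ] at t1' t2'
  simp only [id] at s2 s3 s4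
  rw [hM] at s3
  rw [hα] at s4
  have e2 : Ex E p (fun S => aq q (Cl S u) * (1 - ∑ z ∈ Cl S u, tau2 E p v z)) =
      α - Ex E p (fun S => aq q (Cl S u) * sq E p v (Cl S u)) := by
    rw [← hα u, ← Ex_sub]
    exact Ex_congr fun S _ => by unfold sq; ring
  rw [e2] at s2
  have e1 : Ex E p (fun S => aq q (Cl S u) * (ind (v ∉ Cl S u) * bq q (Cl S v))) -
      Ex E p (fun S => aq q (Cl S u) * sq E p v' (Cl S u) * (ind (v ∉ Cl S u) * bq q (Cl S v))) -
      Ex E p (fun S => aq q (Cl S u) * (ind (v ∉ Cl S u) * (bq q (Cl S v) * sq E p v' (Cl S v)))) ≤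
      Ex E p (fun S => aq q (Cl S u) * (ind (v ∉ Cl S u) * bq q (Cl S v)) *
        (1 - ∑ z ∈ Cl S u ∪ Cl S v, tau2 E p v' z)) := by
    rw [← Ex_sub, ← Ex_sub]
    refine Ex_mono hp0 hp1' fun S _ => ?_
    have h1 := sq_union (E := E) hp0 hp1' v' (Cl S u) (Cl S v)
    have h2 : 0 ≤ aq q (Cl S u) * (ind (v ∉ Cl S u) * bq q (Cl S v)) :=
      mul_nonneg (aq_nonneg hq0 _) (mul_nonneg (ind_nonneg _) (bq_nonneg hq0 hq1' _))
    have h3 := mul_le_mul_of_nonneg_left h1 h2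
    unfold sq at h3 ⊢
    linarith
  have s1' : m * Ex E p (fun S => aq q (Cl S u) * (ind (v ∉ Cl S u) * bq q (Cl S v)) *
        (1 - ∑ z ∈ Cl S u ∪ Cl S v, tau2 E p v' z)) ≤ Tq E p q u v v' := s1
  refine le_trans ?_ s1'
  refine le_trans ?_ (mul_le_mul_of_nonneg_left e1 hm)
  rw [pow_two, mul_assoc]
  refine mul_le_mul_of_nonneg_left ?_ hm
  have f1 := mul_le_mul_of_nonneg_left t1' hm
  have f2 := mul_le_mul_of_nonneg_right t2' hm
  have f3 := mul_le_mul_of_nonneg_left t3' hα0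
  have : 2 * a * m / (1 - q) = 2 * (m * a / (1 - q)) := by ring
  rw [this]
  linarith

/-- The star inequality. -/
theorem star (hp0 : 0 ≤ p) (hp1 : p ≤ 1) {q m : ℝ} (hq0 : 0 ≤ q)
    (hq1 : q ≤ 1) (hM : ∀ x, Ex E p (fun S => bq q (Cl S x)) = m) :
    p ^ 2 * ∑ u : V, ∑ v : V, ∑ v' : V,
      (if s(u, v) ∈ E ∧ s(u, v') ∈ E then Tq E p q u v v' else 0) ≤ 2 * (Fintype.card V * m) := by
  -- for each ghost set and each root
  have key : ∀ (T : Finset V) (x : V), p ^ 2 * ∑ u : V, ∑ v : V, ∑ v' : V,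
      (if s(u, v) ∈ E ∧ s(u, v') ∈ E then Ex E p (fun S => ind (Tri T x S u v v')) else 0) ≤
      2 * Ex E p (fun S => ind (¬ Disjoint (Cl S x) T)) := by
    intro T x
    rw [← Ex_mul_left]
    refine le_trans ?_ (Ex_mono hp0 hp1 fun S _ => TT_sum T x S)
    rw [Ex_sum, Finset.mul_sum]
    refine Finset.sum_le_sum fun u _ => ?_
    rw [Ex_sum, Finset.mul_sum]
    refine Finset.sum_le_sum fun v _ => ?_
    rw [Ex_sum, Finset.mul_sum]
    refine Finset.sum_le_sum fun v' _ => ?_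
    split_ifs with h
    · by_cases hvv : v = v'
      · have : Ex E p (fun S => ind (Tri T x S u v v')) = 0 := by
          rw [← Ex_const (E := E) (p := p) 0]
          refine Ex_congr fun S _ => ind_false fun h => ?_
          subst hvv
          exact h.hvv' (self_mem_Cl _ _)
        rw [this, mul_zero]
        exact Ex_nonneg hp0 hp1 fun _ _ => ind_nonneg _
      have hne : s(u, v) ≠ s(u, v') := fun h' => hvv (Sym2.congr_right.1 h')
      have h1 := Ex_open h.2 hp0 hp1 (fun S => ind (s(u, v) ∉ S) * ind (Tri T x S u v v'))
        (fun S => mul_nonneg (ind_nonneg _) (ind_nonneg _))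
      have h2 := Ex_open h.1 hp0 hp1 (fun S => ind (s(u, v') ∈ S) *
        ind (Tri T x (S.erase s(u, v')) u v v')) (fun S => mul_nonneg (ind_nonneg _) (ind_nonneg _))
      have e1 : Ex E p (fun S => ind (Tri T x S u v v')) =
          Ex E p (fun S => ind (s(u, v') ∉ S) * (ind (s(u, v) ∉ S) * ind (Tri T x S u v v'))) := by
        refine Ex_congr fun S _ => ?_
        by_cases ht : Tri T x S u v v'
        · rw [ind_true ht, ind_true, ind_true]
          · norm_num
          · exact fun h' => ht.huv (mem_Cl.2 (R_step h'))
          · exact fun h' => ht.huv' (mem_Cl.2 (R_step h'))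
        · rw [ind_false ht]; ring
      have e2 : Ex E p (fun S => ind (s(u, v') ∈ S) * (ind (s(u, v) ∉ S.erase s(u, v')) *
            ind (Tri T x (S.erase s(u, v')) u v v'))) =
          Ex E p (fun S => ind (s(u, v) ∉ S) * (ind (s(u, v') ∈ S) *
            ind (Tri T x (S.erase s(u, v')) u v v'))) := by
        refine Ex_congr fun S _ => ?_
        have : ind (s(u, v) ∉ S.erase s(u, v')) = ind (s(u, v) ∉ S) :=
          ind_congr (by rw [Finset.mem_erase]; tauto)
        rw [this]; ring
      have e3 : Ex E p (fun S => ind (s(u, v) ∈ S) * (ind (s(u, v') ∈ S.erase s(u, v)) *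
            ind (Tri T x ((S.erase s(u, v)).erase s(u, v')) u v v'))) =
          Ex E p (fun S => ind (TT T x S u v v')) := by
        refine Ex_congr fun S _ => ?_
        rw [← ind_and, ← ind_and]
        refine ind_congr ?_
        unfold TT
        rw [Finset.mem_erase]
        have := Ne.symm hne
        tauto
      have h1' : p * Ex E p (fun S => ind (s(u, v') ∉ S) * (ind (s(u, v) ∉ S) *
          ind (Tri T x S u v v'))) ≤ Ex E p (fun S => ind (s(u, v') ∈ S) *
            (ind (s(u, v) ∉ S.erase s(u, v')) * ind (Tri T x (S.erase s(u, v')) u v v'))) := by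
        convert h1
      have h2' : p * Ex E p (fun S => ind (s(u, v) ∉ S) * (ind (s(u, v') ∈ S) *
          ind (Tri T x (S.erase s(u, v')) u v v'))) ≤ Ex E p (fun S => ind (s(u, v) ∈ S) *
            (ind (s(u, v') ∈ S.erase s(u, v)) *
            ind (Tri T x ((S.erase s(u, v)).erase s(u, v')) u v v'))) := by
        convert h2
      rw [e2] at h1'
      rw [e3] at h2'
      rw [e1, pow_two, mul_assoc]
      exact (mul_le_mul_of_nonneg_left h1' hp0).trans h2'
    · rw [mul_zero]
      exact Ex_nonneg hp0 hp1 fun _ _ => ind_nonneg _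
  -- average over the ghost field and sum over roots
  have avgR : ∑ x : V, Ex Finset.univ (1 - q) (fun T =>
      2 * Ex E p (fun S => ind (¬ Disjoint (Cl S x) T))) = 2 * (Fintype.card V * m) := by
    have : ∀ x : V, Ex Finset.univ (1 - q) (fun T =>
      2 * Ex E p (fun S => ind (¬ Disjoint (Cl S x) T))) = 2 * m := by
      intro x
      rw [Ex_mul_left, ← Ex_comm, ← hM x]
      congr 1
      exact Ex_congr fun S _ => avg_hit _ _
    simp_rw [this]
    rw [Finset.sum_const, Finset.card_univ, nsmul_eq_mul]; ring
  have avgT : ∀ u v v', Tq E p q u v v' = ∑ x : V, Ex Finset.univ (1 - q) (fun T =>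
      Ex E p (fun S => ind (Tri T x S u v v'))) := by
    intro u v v'
    have : ∀ x : V, Ex Finset.univ (1 - q) (fun T => Ex E p (fun S => ind (Tri T x S u v v'))) =
      Ex E p (fun S => ind (R S u x) * (q ^ (Cl S u).card * (ind (v ∉ Cl S u) * bq q (Cl S v)) *
        (ind (v' ∉ Cl S u ∪ Cl S v) * bq q (Cl S v')))) := by
      intro x
      rw [← Ex_comm]
      refine Ex_congr fun S _ => ?_
      by_cases hd : v ∉ Cl S u ∧ v' ∉ Cl S u ∪ Cl S v
      · rw [ind_true hd.1, ind_true hd.2]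
        have hd2 := hd.2
        rw [Finset.mem_union, not_or] at hd2
        have dj : ∀ a b, b ∉ Cl S a → Disjoint (Cl S a) (Cl S b) := by
          intro a b hab
          rw [Finset.disjoint_left]
          intro c hc hc'
          exact hab (mem_Cl.2 (R_trans (mem_Cl.1 hc) (R_symm (mem_Cl.1 hc'))))
        have := avg_three q (dj u v hd.1) (dj u v' hd2.1) (dj v v' hd2.2)
        rw [one_mul, one_mul, mul_assoc, ← this, ← Ex_mul_left]
        refine Ex_congr fun T _ => ?_
        rw [← ind_and, ← ind_and, ← ind_and]
        refine ind_congr ⟨fun h => ⟨h.hx, h.hu, h.hv, h.hv'⟩, fun h => ?_⟩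
        exact ⟨h.1, h.2.1, h.2.2.1, h.2.2.2, hd.1, hd2.1, hd2.2⟩
      · have e0 : ind (R S u x) * (q ^ (Cl S u).card * (ind (v ∉ Cl S u) * bq q (Cl S v)) *
            (ind (v' ∉ Cl S u ∪ Cl S v) * bq q (Cl S v'))) = 0 := by
          rcases not_and_or.1 hd with h | h <;> rw [ind_false h] <;> ring
        rw [e0, ← Ex_const (E := (Finset.univ : Finset V)) (p := 1 - q) 0]
        refine Ex_congr fun T _ => ind_false fun h => hd ⟨h.huv, ?_⟩
        rw [Finset.mem_union, not_or]
        exact ⟨h.huv', h.hvv'⟩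
    simp_rw [this]
    rw [← Ex_sum]
    refine Ex_congr fun S _ => ?_
    rw [← Finset.sum_mul]
    have : ∑ x : V, ind (R S u x) = (Cl S u).card := by
      unfold ind Cl; simp
    rw [this, aq]; ring
  rw [← avgR]
  refine le_trans (le_of_eq ?_) (Finset.sum_le_sum fun x _ =>
    Ex_mono (by linarith) (by linarith) fun T _ => key T x)
  simp_rw [Ex_mul_left, Ex_sum]
  rw [← Finset.mul_sum]
  congr 1
  symm
  rw [Finset.sum_comm]
  refine Finset.sum_congr rfl fun u _ => ?_
  rw [Finset.sum_comm]
  refine Finset.sum_congr rfl fun v _ => ?_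
  rw [Finset.sum_comm]
  refine Finset.sum_congr rfl fun v' _ => ?_
  split_ifs with h
  · exact (avgT u v v').symm
  · simp_rw [Ex_const]; simp

end diffineq

section diffineq2
variable {V : Type*} [Fintype V] {E : Finset (Sym2 V)} {p : ℝ}

theorem Tq_nonneg (hp0 : 0 ≤ p) (hp1 : p ≤ 1) {q : ℝ} (hq0 : 0 ≤ q) (hq1 : q ≤ 1) (u v v' : V) :
    0 ≤ Tq E p q u v v' := by
  refine Ex_nonneg hp0 hp1 fun S _ => ?_
  have h1 := aq_nonneg hq0 (Cl S u)
  have h2 := bq_nonneg hq0 hq1 (Cl S v)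
  have h3 := bq_nonneg hq0 hq1 (Cl S v')
  have h4 := ind_nonneg (v ∉ Cl S u)
  have h5 := ind_nonneg (v' ∉ Cl S u ∪ Cl S v)
  positivity

theorem star_final (u₀ : V) (hE : ∀ u, s(u, u) ∉ E) {Ω : ℕ}
    (hN : ∀ u : V, (Finset.univ.filter (fun v => s(u, v) ∈ E)).card = Ω)
    (hp0 : 0 ≤ p) (hp1 : p ≤ 1 / 2) {q m α a : ℝ} (hq0 : 0 ≤ q) (hq1 : q < 1)
    (hM : ∀ x, Ex E p (fun S => bq q (Cl S x)) = m)
    (hα : ∀ x, Ex E p (fun S => aq q (Cl S x)) = α)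
    (htri : ∀ x y, x ≠ y → tri2 E p x y ≤ a) :
    p ^ 2 * ((Ω : ℝ) * (Ω - 1) * (m ^ 2 * (α * (1 - a) - 2 * a * m / (1 - q)))) ≤ 2 * m := by
  have hp1' : p ≤ 1 := by linarith
  have h := star hp0 hp1' hq0 hq1.le hM
  set c := m ^ 2 * (α * (1 - a) - 2 * a * m / (1 - q)) with hc
  have hcount : ∀ u : V, ∑ v : V, ∑ v' : V,
      (if s(u, v) ∈ E ∧ s(u, v') ∈ E then (if v = v' then 0 else c) else 0) =
      (Ω : ℝ) * (Ω - 1) * c := by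
    intro u
    have e1 : ∀ v : V, ∑ v' : V,
        (if s(u, v) ∈ E ∧ s(u, v') ∈ E then (if v = v' then 0 else c) else 0) =
        if s(u, v) ∈ E then ((Ω : ℝ) - 1) * c else 0 := by
      intro v
      by_cases hv : s(u, v) ∈ E
      · simp only [hv, true_and, if_true]
        have e2 : ∀ v', (if s(u, v') ∈ E then (if v = v' then 0 else c) else 0) =
            (if s(u, v') ∈ E then c else 0) - (if v = v' then c else 0) := by
          intro v'
          by_cases h' : v = v'
          · subst h'; simp [hv]
          · simp [h']
        simp_rw [e2]
        rw [Finset.sum_sub_distrib, ← Finset.sum_filter, Finset.sum_const, hN]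
        simp; ring
      · simp [hv]
    simp_rw [e1]
    rw [← Finset.sum_filter, Finset.sum_const, hN]
    simp; ring
  have hle : ∑ u : V, ∑ v : V, ∑ v' : V,
      (if s(u, v) ∈ E ∧ s(u, v') ∈ E then (if v = v' then 0 else c) else 0) ≤
      ∑ u : V, ∑ v : V, ∑ v' : V,
      (if s(u, v) ∈ E ∧ s(u, v') ∈ E then Tq E p q u v v' else 0) := by
    refine Finset.sum_le_sum fun u _ => Finset.sum_le_sum fun v _ =>
      Finset.sum_le_sum fun v' _ => ?_
    split_ifs with h1 h2
    · exact Tq_nonneg hp0 hp1' hq0 hq1.le _ _ _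
    · refine Tq_lower hp0 hp1 hq0 hq1 hM hα htri ?_ ?_ h2
      · rintro rfl; exact hE _ h1.1
      · rintro rfl; exact hE _ h1.2
    · exact le_rfl
  simp_rw [hcount] at hle
  rw [Finset.sum_const, Finset.card_univ, nsmul_eq_mul] at hle
  have hV : (0 : ℝ) < Fintype.card V := by
    exact_mod_cast Fintype.card_pos_iff.2 ⟨u₀⟩
  have h2 := (mul_le_mul_of_nonneg_left hle (sq_nonneg p)).trans h
  have h3 : (Fintype.card V : ℝ) * (p ^ 2 * ((Ω : ℝ) * (Ω - 1) * c)) ≤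
      Fintype.card V * (2 * m) := by linarith
  exact le_of_mul_le_mul_left h3 hV

theorem card_Cl (S : Finset (Sym2 V)) (x : V) : ((Cl S x).card : ℝ) = ∑ y : V, ind (R S x y) := by
  unfold ind Cl; simp

theorem chi_bound (u₀ : V) {Ω : ℕ}
    (hN : ∀ u : V, (Finset.univ.filter (fun v => s(u, v) ∈ E)).card = Ω)
    (hp0 : 0 ≤ p) (hp1 : p ≤ 1 / 2) {X : ℝ}
    (hX : ∀ x, Ex E p (fun S => ((Cl S x).card : ℝ)) = X) : X ≤ 1 + Ω * p * X := by
  have hp1' : p ≤ 1 := by linarith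
  have hX' : ∀ x, ∑ y : V, tau2 E p x y = X := by
    intro x
    rw [← hX x]
    simp_rw [card_Cl]
    rw [Ex_sum]; rfl
  have hstep : ∀ y, tau2 E p u₀ y ≤ ind (u₀ = y) +
      ∑ c ∈ Finset.univ.filter (fun v => s(u₀, v) ∈ E), p * tau2 E p c y := by
    intro y
    by_cases hy : u₀ = y
    · rw [ind_true hy, ← hy, tau2_self]
      have : 0 ≤ ∑ c ∈ Finset.univ.filter (fun v => s(u₀, v) ∈ E), p * tau2 E p c u₀ :=
        Finset.sum_nonneg fun c _ => mul_nonneg hp0 (tau2_nonneg hp0 hp1' _ _)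
      linarith
    · rw [ind_false hy, zero_add]
      calc tau2 E p u₀ y ≤ Ex E p (fun S => ∑ c ∈ Finset.univ.filter (fun v => s(u₀, v) ∈ E),
              ind (disj (fun S => s(u₀, c) ∈ S) (fun S => R S c y) S)) := by
            refine Ex_mono hp0 hp1' fun S hS => ind_le_sum _ _ fun h => ?_
            obtain ⟨c, h1, -, h3⟩ := step_split h hy
            exact ⟨c, by simpa using hS h1, h3⟩
        _ = ∑ c ∈ Finset.univ.filter (fun v => s(u₀, v) ∈ E),
              Ex E p (fun S => ind (disj (fun S => s(u₀, c) ∈ S) (fun S => R S c y) S)) :=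
            Ex_sum _ _
        _ ≤ _ := by
            refine Finset.sum_le_sum fun c hc => ?_
            have := BK (E := E) hp0 hp1 (A := fun S => s(u₀, c) ∈ S) (B := fun S => R S c y)
              (fun _ _ h h' => h h') (R_inc c y)
            rw [Ex_mem (by simpa using hc)] at this
            exact this
  rw [← hX' u₀]
  refine (Finset.sum_le_sum fun y _ => hstep y).trans ?_
  rw [Finset.sum_add_distrib, Finset.sum_comm]
  have e1 : ∑ y : V, ind (u₀ = y) = 1 := by unfold ind; simp
  rw [e1]
  simp_rw [← Finset.mul_sum, hX']
  rw [Finset.sum_const, hN, nsmul_eq_mul]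
  linarith

theorem p_le_tri (hp0 : 0 ≤ p) (hp1 : p ≤ 1) {x y : V} (h : s(x, y) ∈ E) : p ≤ tri2 E p x y := by
  have h1 : p ≤ tau2 E p x y := by
    refine le_of_eq_of_le (Ex_mem (p := p) h).symm ?_
    exact Ex_mono hp0 hp1 fun S _ => ind_mono fun h => R_step h
  refine h1.trans ?_
  have h2 : tau2 E p x y = tau2 E p x x * tau2 E p x x * tau2 E p x y := by
    rw [tau2_self]; ring
  rw [h2]
  unfold tri2
  have hn : ∀ u v, 0 ≤ tau2 E p x u * tau2 E p u v * tau2 E p v y := fun u v =>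
    mul_nonneg (mul_nonneg (tau2_nonneg hp0 hp1 _ _) (tau2_nonneg hp0 hp1 _ _))
      (tau2_nonneg hp0 hp1 _ _)
  exact (Finset.single_le_sum (f := fun v => tau2 E p x x * tau2 E p x v * tau2 E p v y)
    (fun v _ => hn x v) (Finset.mem_univ x)).trans
    (Finset.single_le_sum (f := fun u => ∑ v : V, tau2 E p x u * tau2 E p u v * tau2 E p v y)
    (fun u _ => Finset.sum_nonneg fun v _ => hn u v) (Finset.mem_univ x))

theorem Cl_insert_sub (S : Finset (Sym2 V)) (o x y : V) (hx : x ∈ Cl S o) :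
    Cl (insert s(x, y) S) o ⊆ Cl S o ∪ Cl S y := by
  intro z hz
  refine R_ind (mem_Cl.1 hz) (fun z => z ∈ Cl S o ∪ Cl S y)
    (Finset.mem_union_left _ (self_mem_Cl _ _)) ?_
  intro b c _ hb hbc
  rcases Finset.mem_insert.1 hbc with h | h
  · rcases Sym2.eq_iff.1 h with ⟨-, h2⟩ | ⟨-, h2⟩
    · rw [h2]; exact Finset.mem_union_right _ (self_mem_Cl _ _)
    · rw [h2]; exact Finset.mem_union_left _ hx
  · exact Closed_union (Closed_Cl S o) (Closed_Cl S y) b hb c h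

theorem Cl_insert_out (S : Finset (Sym2 V)) (o x y : V) (hx : x ∉ Cl S o) (hy : y ∉ Cl S o) :
    Cl (insert s(x, y) S) o ⊆ Cl S o := by
  intro z hz
  refine R_ind (mem_Cl.1 hz) (fun z => z ∈ Cl S o) (self_mem_Cl _ _) ?_
  intro b c _ hb hbc
  rcases Finset.mem_insert.1 hbc with h | h
  · rcases Sym2.eq_iff.1 h with ⟨h1, -⟩ | ⟨h1, -⟩
    · rw [h1] at hb; exact absurd hb hx
    · rw [h1] at hb; exact absurd hb hy
  · exact Closed_Cl S o b hb c h

/-- The terms in the Aizenman-Barsky inequality. -/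
def Dq (q : ℝ) (o : V) (S : Finset (Sym2 V)) (x y : V) : ℝ :=
  ind (x ∈ Cl S o) * q ^ (Cl S o).card * (ind (y ∉ Cl S o) * bq q (Cl S y))

theorem Dq_nonneg {q : ℝ} (hq0 : 0 ≤ q) (hq1 : q ≤ 1) (o : V) (S : Finset (Sym2 V)) (x y : V) :
    0 ≤ Dq q o S x y := by
  unfold Dq
  have h2 := bq_nonneg hq0 hq1 (Cl S y)
  have h4 := ind_nonneg (x ∈ Cl S o)
  have h5 := ind_nonneg (y ∉ Cl S o)
  positivity

theorem Dq_diff {q : ℝ} (hq0 : 0 ≤ q) (hq1 : q ≤ 1) (o : V) (S : Finset (Sym2 V)) (x y : V)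
    (hx : x ∈ Cl S o) (hy : y ∉ Cl S o) :
    bq q (Cl (insert s(x, y) S) o) - bq q (Cl S o) ≤ Dq q o S x y := by
  unfold Dq
  rw [ind_true hx, ind_true hy]
  have h1 := bq_mono hq0 hq1 (Cl_insert_sub S o x y hx)
  have h2 : q ^ ((Cl S o).card + (Cl S y).card) ≤ q ^ (Cl S o ∪ Cl S y).card :=
    pow_le_pow_of_le_one hq0 hq1 (Finset.card_union_le _ _)
  rw [pow_add] at h2
  unfold bq at *
  linarith

theorem AB_point {q : ℝ} (hq0 : 0 ≤ q) (hq1 : q ≤ 1) (o : V) (S : Finset (Sym2 V)) (e : Sym2 V) :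
    bq q (Cl (insert e S) o) - bq q (Cl S o) ≤
      ∑ x : V, ∑ y : V, if s(x, y) = e then Dq q o S x y else 0 := by
  have hnn : ∀ x y, 0 ≤ (if s(x, y) = e then Dq q o S x y else 0) := by
    intro x y
    split_ifs
    · exact Dq_nonneg hq0 hq1 _ _ _ _
    · exact le_rfl
  have single : ∀ x y, s(x, y) = e → Dq q o S x y ≤
      ∑ x : V, ∑ y : V, if s(x, y) = e then Dq q o S x y else 0 := by
    intro x y h
    have h1 := Finset.single_le_sum (f := fun y => if s(x, y) = e then Dq q o S x y else 0)
      (fun y _ => hnn x y) (Finset.mem_univ y)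
    have h2 := Finset.single_le_sum
      (f := fun x => ∑ y : V, if s(x, y) = e then Dq q o S x y else 0)
      (fun x _ => Finset.sum_nonneg fun y _ => hnn x y) (Finset.mem_univ x)
    simp only [h, if_true] at h1
    exact h1.trans h2
  have hn0 : 0 ≤ ∑ x : V, ∑ y : V, if s(x, y) = e then Dq q o S x y else 0 :=
    Finset.sum_nonneg fun x _ => Finset.sum_nonneg fun y _ => hnn x y
  induction e using Sym2.ind with
  | _ x y =>
    by_cases hx : x ∈ Cl S o
    · by_cases hy : y ∈ Cl S o
      · have h1 := Cl_insert_sub S o x y hx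
        rw [← Cl_eq (mem_Cl.1 hy), Finset.union_self] at h1
        have := bq_mono hq0 hq1 h1
        linarith
      · exact (Dq_diff hq0 hq1 o S x y hx hy).trans (single x y rfl)
    · by_cases hy : y ∈ Cl S o
      · have := (Dq_diff hq0 hq1 o S y x hy hx).trans (single y x Sym2.eq_swap)
        rwa [Sym2.eq_swap (a := y)] at this
      · have := bq_mono hq0 hq1 (Cl_insert_out S o x y hx hy)
        linarith

/-- Aizenman-Barsky inequality. -/
theorem AB {Ω : ℕ}
    (hN : ∀ u : V, (Finset.univ.filter (fun v => s(u, v) ∈ E)).card = Ω)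
    (hp0 : 0 ≤ p) (hp1 : p ≤ 1) {q m : ℝ} (hq0 : 0 ≤ q) (hq1 : q ≤ 1)
    (hM : ∀ x, Ex E p (fun S => bq q (Cl S x)) = m) (o : V) :
    (1 - p) * ∑ e ∈ E, Ex E p (fun S => bq q (Cl (insert e S) o) - bq q (Cl (S.erase e) o)) ≤
      Ω * (m * Ex E p (fun S => aq q (Cl S o))) := by
  have h1 : (1 - p) * ∑ e ∈ E,
      Ex E p (fun S => bq q (Cl (insert e S) o) - bq q (Cl (S.erase e) o)) =
      ∑ e ∈ E, Ex E p (fun S => bq q (Cl (insert e S) o) - bq q (Cl S o)) := by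
    rw [Finset.mul_sum]
    refine Finset.sum_congr rfl fun e he => ?_
    convert Ex_russo he (fun S => bq q (Cl S o))
  rw [h1]
  have h2 : ∀ e ∈ E, Ex E p (fun S => bq q (Cl (insert e S) o) - bq q (Cl S o)) ≤
      ∑ x : V, ∑ y : V, if s(x, y) = e then Ex E p (fun S => Dq q o S x y) else 0 := by
    intro e _
    refine (Ex_mono hp0 hp1 fun S _ => AB_point hq0 hq1 o S e).trans (le_of_eq ?_)
    rw [Ex_sum]
    refine Finset.sum_congr rfl fun x _ => ?_
    rw [Ex_sum]
    refine Finset.sum_congr rfl fun y _ => ?_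
    split_ifs
    · rfl
    · exact Ex_const 0
  refine (Finset.sum_le_sum h2).trans ?_
  have h3 : ∑ e ∈ E, ∑ x : V, ∑ y : V,
      (if s(x, y) = e then Ex E p (fun S => Dq q o S x y) else 0) =
      ∑ x : V, ∑ y ∈ Finset.univ.filter (fun v => s(x, v) ∈ E),
        Ex E p (fun S => Dq q o S x y) := by
    rw [Finset.sum_comm]
    refine Finset.sum_congr rfl fun x _ => ?_
    rw [Finset.sum_comm, Finset.sum_filter]
    refine Finset.sum_congr rfl fun y _ => ?_
    rw [Finset.sum_ite_eq]
  rw [h3]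
  have h4 : ∀ x y, Ex E p (fun S => Dq q o S x y) ≤
      Ex E p (fun S => ind (x ∈ Cl S o) * q ^ (Cl S o).card) * m := by
    intro x y
    rw [← hM y]
    exact cond_le (E := E) (reg := id) hp0 hp1 (hdet1 o) (fun S => Closed_Cl S o)
      (fun A => ind (x ∈ A) * q ^ A.card)
      (fun i => mul_nonneg (ind_nonneg _) (pow_nonneg hq0 _)) (bq q)
      (bq_nonneg hq0 hq1) (fun C D h => bq_mono hq0 hq1 h) y
  refine (Finset.sum_le_sum fun x _ => Finset.sum_le_sum fun y _ => h4 x y).trans (le_of_eq ?_)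
  simp_rw [Finset.sum_const, hN, nsmul_eq_mul]
  rw [← Finset.mul_sum, ← Finset.sum_mul, ← Ex_sum]
  rw [mul_comm m]
  congr 2
  refine Ex_congr fun S _ => ?_
  rw [← Finset.sum_mul, aq]
  congr 1
  rw [card_Cl]
  exact Finset.sum_congr rfl fun x _ => ind_congr mem_Cl

end diffineq2

section analysis
variable {V : Type*} [Fintype V] {E : Finset (Sym2 V)} {p : ℝ}

/-- The magnetization. -/
def Mf (E : Finset (Sym2 V)) (o : V) (p γ : ℝ) : ℝ := Ex E p (fun S => bq (1 - γ) (Cl S o))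

/-- The derivative of the magnetization with respect to the second variable. -/
def Mg (E : Finset (Sym2 V)) (o : V) (p γ : ℝ) : ℝ :=
  Ex E p (fun S => ((Cl S o).card : ℝ) * (1 - γ) ^ ((Cl S o).card - 1))

theorem Mf_nonneg (hp0 : 0 ≤ p) (hp1 : p ≤ 1) {γ : ℝ} (h0 : 0 ≤ γ) (h1 : γ ≤ 1) (o : V) :
    0 ≤ Mf E o p γ :=
  Ex_nonneg hp0 hp1 fun _ _ => bq_nonneg (by linarith) (by linarith) _

theorem Mf_le_one (hp0 : 0 ≤ p) (hp1 : p ≤ 1) {γ : ℝ} (h1 : γ ≤ 1) (o : V) :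
    Mf E o p γ ≤ 1 := by
  have := Ex_mono (E := E) hp0 hp1 (f := fun S => bq (1 - γ) (Cl S o)) (g := fun _ => 1) (by
    intro S _
    have : 0 ≤ (1 - γ) ^ (Cl S o).card := pow_nonneg (by linarith) _
    unfold bq; linarith)
  rwa [Ex_const] at this

theorem Mf_zero (o : V) : Mf E o p 0 = 0 := by
  unfold Mf
  refine (Ex_congr (g := fun _ => 0) fun S _ => ?_).trans (Ex_const (E := E) (p := p) 0)
  simp [bq]

theorem Mg_nonneg (hp0 : 0 ≤ p) (hp1 : p ≤ 1) {γ : ℝ} (h1 : γ ≤ 1) (o : V) :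
    0 ≤ Mg E o p γ :=
  Ex_nonneg hp0 hp1 fun _ _ => mul_nonneg (Nat.cast_nonneg _) (pow_nonneg (by linarith) _)

theorem aq_Mg (γ : ℝ) (o : V) :
    Ex E p (fun S => aq (1 - γ) (Cl S o)) = (1 - γ) * Mg E o p γ := by
  unfold Mg
  rw [← Ex_mul_left]
  refine Ex_congr fun S _ => ?_
  unfold aq
  have hpos : 0 < (Cl S o).card := Finset.card_pos.2 ⟨o, self_mem_Cl _ _⟩
  obtain ⟨n, hn⟩ := Nat.exists_eq_succ_of_ne_zero hpos.ne'
  rw [hn]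
  simp only [Nat.succ_eq_add_one, Nat.add_sub_cancel]
  ring

theorem Mf_deriv (o : V) (P G : ℝ → ℝ) (P' G' t : ℝ) (hP : HasDerivAt P P' t)
    (hG : HasDerivAt G G' t) :
    HasDerivAt (fun t => Mf E o (P t) (G t))
      (P' * (∑ e ∈ E, Ex E (P t) (fun S => bq (1 - G t) (Cl (insert e S) o) -
        bq (1 - G t) (Cl (S.erase e) o))) + G' * Mg E o (P t) (G t)) t := by
  have h := Ex_hasDerivAt (E := E) P P' t hP (fun t S => bq (1 - G t) (Cl S o))
    (fun S => G' * (((Cl S o).card : ℝ) * (1 - G t) ^ ((Cl S o).card - 1))) (by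
      intro S
      unfold bq
      have h1 := ((hG.const_sub 1).fun_pow (Cl S o).card).const_sub 1
      refine h1.congr_deriv ?_
      ring)
  rw [Ex_mul_left] at h
  unfold Mf Mg
  convert h

/-- The differential inequality at the critical point gives the square-root bound. -/
theorem Mf_sq (u₀ : V) (hE : ∀ u, s(u, u) ∉ E) {Ω : ℕ}
    (hN : ∀ u : V, (Finset.univ.filter (fun v => s(u, v) ∈ E)).card = Ω)
    (hinv : ∀ (f : Finset V → ℝ), (∀ C D, C.card = D.card → f C = f D) → ∀ x y : V,
      Ex E p (fun S => f (Cl S x)) = Ex E p (fun S => f (Cl S y)))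
    (hp0 : 0 ≤ p) {a : ℝ} (hpa : p ≤ a) (ha : a ≤ 1 / 1000) (hΩ : 999 / 1000 ≤ Ω * p)
    (htri : ∀ x y, x ≠ y → tri2 E p x y ≤ a) {γ : ℝ} (h0 : 0 ≤ γ) (h1 : γ ≤ 1) :
    Mf E u₀ p γ ^ 2 ≤ 10 * γ := by
  have hp1 : p ≤ 1 / 2 := by linarith
  have hp1' : p ≤ 1 := by linarith
  rcases le_total (1 / 2) γ with hγ | hγ
  · have h2 := Mf_nonneg (E := E) hp0 hp1' h0 h1 u₀
    have h3 := Mf_le_one (E := E) hp0 hp1' h1 u₀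
    nlinarith
  have hd : ∀ x, HasDerivAt (fun t => Mf E u₀ p t ^ 2) (2 * Mf E u₀ p x * Mg E u₀ p x) x := by
    intro x
    have h1 := (Mf_deriv (E := E) u₀ (fun _ => p) id 0 1 x (hasDerivAt_const x p)
      (hasDerivAt_id x)).fun_pow 2
    refine h1.congr_deriv ?_
    simp only [id]
    push_cast
    ring
  refine image_le_of_deriv_right_lt_deriv_boundary' (f := fun t => Mf E u₀ p t ^ 2)
    (f' := fun x => 2 * Mf E u₀ p x * Mg E u₀ p x) (a := 0) (b := 1 / 2)
    (fun x _ => (hd x).continuousAt.continuousWithinAt) (fun x _ => (hd x).hasDerivWithinAt)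
    (B := fun t => 10 * t) (B' := fun _ => 10) ?_ (by fun_prop)
    (fun x _ => by simpa using ((hasDerivAt_id x).const_mul (10 : ℝ)).hasDerivWithinAt)
    ?_ ⟨h0, hγ⟩
  · simp [Mf_zero]
  · intro x hx heq
    rcases eq_or_lt_of_le hx.1 with hx0 | hx0
    · rw [← hx0, Mf_zero]; norm_num
    have hx1 := hx.2
    have hs := star_final u₀ hE hN hp0 hp1 (q := 1 - x) (m := Mf E u₀ p x)
      (α := (1 - x) * Mg E u₀ p x) (a := a) (by linarith) (by linarith)
      (fun y => hinv (bq (1 - x)) (fun C D h => by unfold bq; rw [h]) y u₀)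
      (fun y => by
        rw [hinv (aq (1 - x)) (fun C D h => by unfold aq; rw [h]) y u₀, aq_Mg]) htri
    have hm0 := Mf_nonneg (E := E) hp0 hp1' hx.1 (by linarith) u₀
    have hg0 := Mg_nonneg (E := E) hp0 hp1' (γ := x) (by linarith) u₀
    generalize Mf E u₀ p x = m at *
    generalize Mg E u₀ p x = g at *
    have hm : 0 < m := by
      rcases eq_or_lt_of_le hm0 with h | h
      · rw [← h] at heq; nlinarith
      · exact h
    have ha0 : 0 ≤ a := hp0.trans hpa
    have e1 : 2 * a * m / (1 - (1 - x)) * m = 20 * a := by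
      have : 1 - (1 - x) = x := by ring
      rw [this]
      field_simp
      nlinarith
    set Q := 2 * a * m / (1 - (1 - x)) with hQ
    have hκ : 997 / 1000 ≤ p ^ 2 * ((Ω : ℝ) * (Ω - 1)) := by nlinarith
    set κ := p ^ 2 * ((Ω : ℝ) * (Ω - 1)) with hk
    have hs' : κ * (m * (((1 - x) * g * (1 - a) - Q))) ≤ 2 := by
      refine le_of_mul_le_mul_right ?_ hm
      calc _ = p ^ 2 * (↑Ω * (↑Ω - 1) * (m ^ 2 * ((1 - x) * g * (1 - a) - Q))) := by
            rw [hk]; ring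
        _ ≤ _ := hs
    have e2 : m * (((1 - x) * g * (1 - a) - Q)) = m * g * (1 - x) * (1 - a) - 20 * a := by
      rw [← e1]; ring
    rw [e2] at hs'
    have hmg : 0 ≤ m * g := mul_nonneg hm0 hg0
    have h3 : m * g * (1 - x) * (1 - a) - 20 * a ≤ 2 / (997 / 1000) := by
      rw [le_div_iff₀ (by norm_num)]
      by_cases hz : 0 ≤ m * g * (1 - x) * (1 - a) - 20 * a
      · nlinarith
      · nlinarith
    have h4 : m * g * (1 / 2) * (999 / 1000) ≤ m * g * (1 - x) * (1 - a) := by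
      have e3 : (1 / 2 : ℝ) ≤ 1 - x := by linarith
      have e4 : (999 / 1000 : ℝ) ≤ 1 - a := by linarith
      gcongr
    have : (2 : ℝ) / (997 / 1000) ≤ 2.007 := by norm_num
    nlinarith

/-- Extrapolation along the characteristic. -/
theorem extrap (u₀ : V) {Ω : ℕ}
    (hN : ∀ u : V, (Finset.univ.filter (fun v => s(u, v) ∈ E)).card = Ω)
    (hinv : ∀ (r : ℝ) (f : Finset V → ℝ), (∀ C D, C.card = D.card → f C = f D) → ∀ x y : V,
      Ex E r (fun S => f (Cl S x)) = Ex E r (fun S => f (Cl S y)))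
    {pc T γ : ℝ} (hpc : 0 ≤ pc) (hT : 0 ≤ T) (hp : pc + T < 1) (hγ : 0 ≤ γ) (hγ1 : γ ≤ 1)
    (hle : γ + Ω / (1 - (pc + T)) * Mf E u₀ (pc + T) γ * T ≤ 1) :
    Mf E u₀ (pc + T) γ ≤ Mf E u₀ pc (γ + Ω / (1 - (pc + T)) * Mf E u₀ (pc + T) γ * T) := by
  set K : ℝ := Ω / (1 - (pc + T)) with hK
  have hK0 : 0 ≤ K := div_nonneg (Nat.cast_nonneg _) (by linarith)
  set m := Mf E u₀ (pc + T) γ with hm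
  have hm0 : 0 ≤ m := Mf_nonneg (by linarith) hp.le hγ hγ1 u₀
  have hKm : 0 ≤ K * m := mul_nonneg hK0 hm0
  set P : ℝ → ℝ := fun s => pc + T - s with hP
  set G : ℝ → ℝ := fun s => γ + K * m * s with hG
  have hPd : ∀ s, HasDerivAt P (-1) s := fun s => by
    simpa using (hasDerivAt_id s).const_sub (pc + T)
  have hGd : ∀ s, HasDerivAt G (K * m) s := fun s =>
    (((hasDerivAt_id s).const_mul (K * m)).const_add γ).congr_deriv (mul_one _)
  have hd := fun s => (Mf_deriv (E := E) u₀ P G (-1) (K * m) s (hPd s) (hGd s)).const_sub m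
  have main : ∀ δ : ℝ, 0 < δ → m - Mf E u₀ (P T) (G T) ≤ δ * (1 + T) := by
    intro δ hδ
    refine image_le_of_deriv_right_lt_deriv_boundary' (a := 0) (b := T)
      (f := fun s => m - Mf E u₀ (P s) (G s))
      (fun x _ => (hd x).continuousAt.continuousWithinAt) (fun x _ => (hd x).hasDerivWithinAt)
      (B := fun s => δ * (1 + s)) (B' := fun _ => δ) ?_ (by fun_prop)
      (fun x _ => by
        simpa using (((hasDerivAt_id x).const_add (1 : ℝ)).const_mul δ).hasDerivWithinAt)
      ?_ ⟨hT, le_rfl⟩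
    · have : m - Mf E u₀ (P 0) (G 0) = 0 := by simp [hP, hG, hm]
      show m - Mf E u₀ (P 0) (G 0) ≤ δ * (1 + 0)
      rw [this]; linarith
    · intro s hs heq
      have hs0 := hs.1
      have hs1 := hs.2
      have hP0 : 0 ≤ P s := by simp only [hP]; linarith
      have hPp : P s ≤ pc + T := by simp only [hP]; linarith
      have hP1 : P s < 1 := by linarith
      have hG0 : 0 ≤ G s := by simp only [hG]; nlinarith
      have hG1 : G s ≤ 1 := by simp only [hG]; nlinarith
      have hAB := AB (E := E) hN hP0 hP1.le (q := 1 - G s) (m := Mf E u₀ (P s) (G s))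
        (by linarith) (by linarith)
        (fun y => hinv (P s) (bq (1 - G s)) (fun C D h => by unfold bq; rw [h]) y u₀) u₀
      rw [aq_Mg] at hAB
      set D := ∑ e ∈ E, Ex E (P s) (fun S => bq (1 - G s) (Cl (insert e S) u₀) -
        bq (1 - G s) (Cl (S.erase e) u₀)) with hD
      have hh0 := Mf_nonneg (E := E) hP0 hP1.le hG0 hG1 u₀
      have hg0 := Mg_nonneg (E := E) hP0 hP1.le hG1 u₀
      have heq' : m - Mf E u₀ (P s) (G s) = δ * (1 + s) := heq
      generalize Mf E u₀ (P s) (G s) = h at *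
      generalize Mg E u₀ (P s) (G s) = g at *
      have h1 : D ≤ K * (h * g) := by
        have hpos : 0 < 1 - P s := by linarith
        have h2 : D ≤ (Ω : ℝ) * (h * ((1 - G s) * g)) / (1 - P s) := by
          rw [le_div_iff₀ hpos]; linarith
        refine h2.trans ?_
        rw [hK, div_mul_eq_mul_div]
        have h3 : (1 - G s) * g ≤ g := by nlinarith
        have h4 : 0 < 1 - (pc + T) := by linarith
        gcongr
      have h2 : 0 ≤ K * g * (m - h) := by
        rw [heq']
        have : 0 ≤ 1 + s := by linarith
        positivity
      linarith
  have hPT : P T = pc := by simp [hP]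
  rw [hPT] at main
  have hfin : m - Mf E u₀ pc (G T) ≤ 0 := by
    by_contra hneg
    push Not at hneg
    have := main ((m - Mf E u₀ pc (G T)) / (2 * (1 + T))) (by positivity)
    rw [div_mul_eq_mul_div, le_div_iff₀ (by positivity)] at this
    have h1T : 0 < 1 + T := by linarith
    nlinarith [mul_pos hneg h1T]
  have : Mf E u₀ pc (G T) = Mf E u₀ pc (γ + K * m * T) := rfl
  linarith

/-- The supercritical magnetization bound. -/
theorem Mf_super (u₀ : V) (hE : ∀ u, s(u, u) ∉ E) {Ω : ℕ}
    (hN : ∀ u : V, (Finset.univ.filter (fun v => s(u, v) ∈ E)).card = Ω)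
    (hinv : ∀ (r : ℝ) (f : Finset V → ℝ), (∀ C D, C.card = D.card → f C = f D) → ∀ x y : V,
      Ex E r (fun S => f (Cl S x)) = Ex E r (fun S => f (Cl S y)))
    {pc a : ℝ} (hpc : 0 ≤ pc) (hpa : pc ≤ a) (ha : a ≤ 1 / 1000) (hΩ : 999 / 1000 ≤ Ω * pc)
    (htri : ∀ x y, x ≠ y → tri2 E pc x y ≤ a) {T γ : ℝ} (hT : 0 ≤ T) (hp : pc + T < 1)
    (hγ : 0 ≤ γ) (hγ1 : γ ≤ 1) :
    Mf E u₀ (pc + T) γ ≤ 10 * (Ω / (1 - (pc + T)) * T) + √10 * √γ := by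
  set K : ℝ := Ω / (1 - (pc + T)) with hK
  have hK0 : 0 ≤ K := div_nonneg (Nat.cast_nonneg _) (by linarith)
  have hm0 : 0 ≤ Mf E u₀ (pc + T) γ := Mf_nonneg (by linarith) hp.le hγ hγ1 u₀
  have hm1 : Mf E u₀ (pc + T) γ ≤ 1 := Mf_le_one (by linarith) hp.le hγ1 u₀
  have hsq : Mf E u₀ (pc + T) γ ^ 2 ≤ 10 * (γ + K * Mf E u₀ (pc + T) γ * T) := by
    rcases le_or_gt (γ + K * Mf E u₀ (pc + T) γ * T) 1 with h | h
    · have h1 := extrap (E := E) u₀ hN hinv hpc hT hp hγ hγ1 h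
      have h2 := Mf_sq (E := E) u₀ hE hN (hinv pc) hpc hpa ha hΩ htri
        (γ := γ + K * Mf E u₀ (pc + T) γ * T) (by positivity) h
      exact (pow_le_pow_left₀ hm0 h1 2).trans h2
    · nlinarith
  generalize Mf E u₀ (pc + T) γ = m at *
  rw [← Real.sqrt_mul (by norm_num)]
  have hs0 := Real.sqrt_nonneg (10 * γ)
  have hs := Real.sq_sqrt (show 0 ≤ 10 * γ by linarith)
  set d := √(10 * γ)
  have hKT : 0 ≤ K * T := mul_nonneg hK0 hT
  by_contra hlt
  push Not at hlt
  nlinarith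
end analysis

section bridge
variable {V : Type*} [Fintype V]

theorem map_R {S S' : Finset (Sym2 V)} (σ : V → V) (h : ∀ b c, s(b, c) ∈ S → s(σ b, σ c) ∈ S')
    {x y : V} (hr : R S x y) : R S' (σ x) (σ y) :=
  R_ind hr (fun y => R S' (σ x) (σ y)) (R_refl _ _) fun _ _ _ hb hbc =>
    R_trans hb (R_step (h _ _ hbc))

theorem Ex_map {E : Finset (Sym2 V)} (r : ℝ) (σ : V ≃ V)
    (hσ : ∀ e, Sym2.map σ e ∈ E ↔ e ∈ E) (F : Finset (Sym2 V) → ℝ) :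
    Ex E r F = Ex E r (fun S => F (S.image (Sym2.map σ))) := by
  unfold Ex
  have c1 : ∀ e, Sym2.map σ (Sym2.map σ.symm e) = e := by
    intro e; rw [Sym2.map_map]; simp
  have c2 : ∀ e, Sym2.map σ.symm (Sym2.map σ e) = e := by
    intro e; rw [Sym2.map_map]; simp
  have hσ' : ∀ e, Sym2.map σ.symm e ∈ E ↔ e ∈ E := by
    intro e; rw [← hσ, c1]
  have i1 : ∀ S : Finset (Sym2 V), (S.image (Sym2.map σ.symm)).image (Sym2.map σ) = S := by
    intro S
    rw [Finset.image_image]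
    have : (Sym2.map σ ∘ Sym2.map σ.symm : Sym2 V → Sym2 V) = id := funext c1
    rw [this, Finset.image_id]
  have i2 : ∀ S : Finset (Sym2 V), (S.image (Sym2.map σ)).image (Sym2.map σ.symm) = S := by
    intro S
    rw [Finset.image_image]
    have : (Sym2.map σ.symm ∘ Sym2.map σ : Sym2 V → Sym2 V) = id := funext c2
    rw [this, Finset.image_id]
  refine Finset.sum_nbij' (fun S => S.image (Sym2.map σ.symm)) (fun S => S.image (Sym2.map σ))
    ?_ ?_ ?_ ?_ ?_
  · intro S hS
    rw [Finset.mem_powerset] at hS ⊢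
    intro e he
    obtain ⟨d, hd, rfl⟩ := Finset.mem_image.1 he
    exact (hσ' d).2 (hS hd)
  · intro S hS
    rw [Finset.mem_powerset] at hS ⊢
    intro e he
    obtain ⟨d, hd, rfl⟩ := Finset.mem_image.1 he
    exact (hσ d).2 (hS hd)
  · intro S _; exact i1 S
  · intro S _; exact i2 S
  · intro S _
    have hc : (S.image (Sym2.map σ.symm)).card = S.card :=
      Finset.card_image_of_injective _ (Sym2.map.injective σ.symm.injective)
    simp only [hc, i1]

theorem Cl_image_card (σ : V ≃ V) (S : Finset (Sym2 V)) (x : V) :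
    (Cl (S.image (Sym2.map σ)) (σ x)).card = (Cl S x).card := by
  symm
  refine Finset.card_bij (fun y _ => σ y) ?_ (fun _ _ _ _ h => σ.injective h) ?_
  · intro y hy
    refine mem_Cl.2 (map_R σ (fun b c h => ?_) (mem_Cl.1 hy))
    exact Finset.mem_image.2 ⟨_, h, by simp⟩
  · intro z hz
    refine ⟨σ.symm z, ?_, by simp⟩
    have := map_R (S' := S) σ.symm (fun b c h => ?_) (mem_Cl.1 hz)
    · rw [Equiv.symm_apply_apply] at this
      exact mem_Cl.2 this
    · obtain ⟨d, hd, he⟩ := Finset.mem_image.1 h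
      have : d = s(σ.symm b, σ.symm c) := by
        apply Sym2.map.injective σ.injective
        rw [he]; simp
      rwa [← this]

theorem inv_Ex {E : Finset (Sym2 V)} (h : ∀ x y : V, ∃ σ : V ≃ V, σ x = y ∧
    ∀ e, Sym2.map σ e ∈ E ↔ e ∈ E) (r : ℝ) (f : Finset V → ℝ)
    (hf : ∀ C D, C.card = D.card → f C = f D) (x y : V) :
    Ex E r (fun S => f (Cl S x)) = Ex E r (fun S => f (Cl S y)) := by
  obtain ⟨σ, rfl, hσ⟩ := h x y
  rw [Ex_map r σ hσ (fun S => f (Cl S (σ x)))]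
  exact Ex_congr fun S _ => (hf _ _ (Cl_image_card σ S x)).symm

/-- The size of the largest cluster. -/
def maxC (S : Finset (Sym2 V)) : ℕ := Finset.univ.sup fun x => (Cl S x).card

theorem maxC_le (S : Finset (Sym2 V)) : maxC S ≤ Fintype.card V :=
  Finset.sup_le fun x _ => Finset.card_le_univ _

theorem maxC_le_Z (S : Finset (Sym2 V)) {k : ℝ} (hk : 0 ≤ k) :
    (maxC S : ℝ) ≤ k + ∑ x : V, ind (k ≤ ((Cl S x).card : ℝ)) := by
  have hn : 0 ≤ ∑ x : V, ind (k ≤ ((Cl S x).card : ℝ)) :=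
    Finset.sum_nonneg fun x _ => ind_nonneg _
  by_cases hlt : (maxC S : ℝ) ≤ k
  · linarith
  push Not at hlt
  have hne : (Finset.univ : Finset V).Nonempty := by
    by_contra he
    rw [Finset.not_nonempty_iff_eq_empty] at he
    have : maxC S = 0 := by unfold maxC; rw [he]; rfl
    rw [this] at hlt
    simp at hlt
    linarith
  obtain ⟨x, -, hx⟩ := Finset.exists_mem_eq_sup (Finset.univ : Finset V) hne
    (fun x => (Cl S x).card)
  have hx' : maxC S = (Cl S x).card := hx
  rw [hx'] at hlt ⊢
  have : ((Cl S x).card : ℝ) ≤ ∑ y : V, ind (k ≤ ((Cl S y).card : ℝ)) := by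
    rw [card_Cl]
    refine Finset.sum_le_sum fun y _ => ind_mono fun hy => ?_
    rw [← Cl_eq hy]
    exact hlt.le
  linarith

theorem bq_large {C : Finset V} {γ : ℝ} (hγ : 0 < γ) (hγ1 : γ ≤ 1) (h : γ⁻¹ ≤ (C.card : ℝ)) :
    1 ≤ 1.6 * bq (1 - γ) C := by
  have h1 : (1 - γ) ^ C.card ≤ Real.exp (-γ) ^ C.card :=
    pow_le_pow_left₀ (by linarith) (Real.one_sub_le_exp_neg γ) _
  rw [← Real.exp_nat_mul] at h1
  have h2 : Real.exp ((C.card : ℝ) * -γ) ≤ Real.exp (-1) := by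
    apply Real.exp_le_exp.2
    rw [inv_le_iff_one_le_mul₀ hγ] at h
    linarith
  have h3 : Real.exp (-1) ≤ 0.375 := by
    rw [Real.exp_neg]
    have := Real.exp_one_gt_d9
    rw [inv_le_comm₀ (by positivity) (by norm_num)]
    norm_num at this ⊢
    linarith
  unfold bq
  norm_num at h3 ⊢
  linarith

theorem maxC_Ex {E : Finset (Sym2 V)} (u₀ : V) (hE : ∀ u, s(u, u) ∉ E) {Ω : ℕ}
    (hN : ∀ u : V, (Finset.univ.filter (fun v => s(u, v) ∈ E)).card = Ω)
    (hinv : ∀ (r : ℝ) (f : Finset V → ℝ), (∀ C D, C.card = D.card → f C = f D) → ∀ x y : V,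
      Ex E r (fun S => f (Cl S x)) = Ex E r (fun S => f (Cl S y)))
    {pc a : ℝ} (hpc : 0 ≤ pc) (hpa : pc ≤ a) (ha : a ≤ 1 / 1000) (hΩ : 999 / 1000 ≤ Ω * pc)
    (htri : ∀ x y, x ≠ y → tri2 E pc x y ≤ a) {ε : ℝ} (hε : 0 ≤ ε) (hΩ1 : 1 ≤ Ω)
    (hp : pc + ε * (Ω : ℝ)⁻¹ ≤ 1) :
    Ex E (pc + ε * (Ω : ℝ)⁻¹) (fun S => (maxC S : ℝ)) ≤
      21 * ε * (Fintype.card V : ℝ) + 7 * (Fintype.card V : ℝ) ^ ((2 : ℝ) / 3) := by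
  have hΩr : (1 : ℝ) ≤ Ω := by exact_mod_cast hΩ1
  have hT0 : 0 ≤ ε * (Ω : ℝ)⁻¹ := by positivity
  have hn1 : (1 : ℝ) ≤ Fintype.card V := by
    exact_mod_cast Fintype.card_pos_iff.2 ⟨u₀⟩
  set n : ℝ := (Fintype.card V : ℝ) with hn
  have hn0 : 0 ≤ n := by linarith
  have hnp : 0 < n := by linarith
  have hk0 : 0 < n ^ ((2 : ℝ) / 3) := Real.rpow_pos_of_pos hnp _
  rcases le_total (1 / 21) ε with hbig | hsmall
  · have h1 : Ex E (pc + ε * (Ω : ℝ)⁻¹) (fun S => (maxC S : ℝ)) ≤ n := by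
      have := Ex_mono (E := E) (p := pc + ε * (Ω : ℝ)⁻¹) (by linarith) hp
        (f := fun S => (maxC S : ℝ)) (g := fun _ => n)
        (fun S _ => by rw [hn]; exact_mod_cast maxC_le S)
      rwa [Ex_const] at this
    nlinarith
  have hTε : ε * (Ω : ℝ)⁻¹ ≤ ε := by
    have : (Ω : ℝ)⁻¹ ≤ 1 := inv_le_one_of_one_le₀ hΩr
    nlinarith
  have hp1 : pc + ε * (Ω : ℝ)⁻¹ < 1 := by linarith
  set γ : ℝ := (n ^ ((2 : ℝ) / 3))⁻¹ with hγ
  have hγ0 : 0 < γ := inv_pos.2 hk0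
  have hγ1 : γ ≤ 1 := inv_le_one_of_one_le₀ (Real.one_le_rpow hn1 (by norm_num))
  have hM := Mf_super u₀ hE hN hinv hpc hpa ha hΩ htri hT0 hp1 hγ0.le hγ1
  have hK : (Ω : ℝ) / (1 - (pc + ε * (Ω : ℝ)⁻¹)) * (ε * (Ω : ℝ)⁻¹) =
      ε / (1 - (pc + ε * (Ω : ℝ)⁻¹)) := by
    field_simp
  rw [hK] at hM
  have hsγ : √γ = n ^ (-(1 : ℝ) / 3) := by
    rw [hγ, ← Real.rpow_neg hn0, Real.sqrt_eq_rpow, ← Real.rpow_mul hn0]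
    norm_num
  have hnγ : n * √γ = n ^ ((2 : ℝ) / 3) := by
    rw [hsγ]
    nth_rewrite 1 [← Real.rpow_one n]
    rw [← Real.rpow_add hnp]
    norm_num
  have h10 : √10 ≤ 3.2 := by
    rw [Real.sqrt_le_left (by norm_num)]; norm_num
  set p := pc + ε * (Ω : ℝ)⁻¹ with hpdef
  have hp0 : 0 ≤ p := by linarith
  have hM2 : Mf E u₀ p γ ≤ 10.6 * ε + 3.2 * √γ := by
    have h1 : ε / (1 - p) ≤ 1.06 * ε := by
      rw [div_le_iff₀ (by linarith)]
      nlinarith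
    have h2 := mul_le_mul_of_nonneg_right h10 (Real.sqrt_nonneg γ)
    linarith
  calc Ex E p (fun S => (maxC S : ℝ))
      ≤ Ex E p (fun S => n ^ ((2 : ℝ) / 3) + ∑ x : V, 1.6 * bq (1 - γ) (Cl S x)) := by
        refine Ex_mono hp0 hp1.le fun S _ => (maxC_le_Z S hk0.le).trans ?_
        gcongr with x _
        by_cases hx : n ^ ((2 : ℝ) / 3) ≤ ((Cl S x).card : ℝ)
        · rw [ind_true hx]
          exact bq_large hγ0 hγ1 (by rw [hγ, inv_inv]; exact hx)
        · rw [ind_false hx]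
          have := bq_nonneg (q := 1 - γ) (by linarith) (by linarith) (Cl S x)
          positivity
    _ = n ^ ((2 : ℝ) / 3) + n * (1.6 * Mf E u₀ p γ) := by
        rw [Ex_add, Ex_const, Ex_sum]
        congr 1
        have : ∀ x : V, Ex E p (fun S => 1.6 * bq (1 - γ) (Cl S x)) = 1.6 * Mf E u₀ p γ := by
          intro x
          rw [Ex_mul_left, hinv p (bq (1 - γ)) (fun C D h => by unfold bq; rw [h]) x u₀, Mf]
        simp_rw [this]
        rw [Finset.sum_const, Finset.card_univ, nsmul_eq_mul]
    _ ≤ n ^ ((2 : ℝ) / 3) + n * (1.6 * (10.6 * ε + 3.2 * √γ)) := by gcongr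
    _ = n ^ ((2 : ℝ) / 3) + 1.6 * 10.6 * (ε * n) + 1.6 * 3.2 * (n * √γ) := by ring
    _ ≤ _ := by
        rw [hnγ]
        have : 0 ≤ ε * n := mul_nonneg hε hn0
        nlinarith

end bridge

section final
open Percolation
variable {V : Type*} [Fintype V] [DecidableEq V] (G : SimpleGraph V)

/-- The edge set as a finset. -/
def EE : Finset (Sym2 V) := Finset.univ.filter (fun e => e ∈ G.edgeSet)

theorem mem_EE (e : Sym2 V) : e ∈ EE G ↔ e ∈ G.edgeSet := by simp [EE]

/-- The set of open bonds. -/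
def opn (ω : Config G) : Finset (Sym2 V) :=
  Finset.univ.filter (fun e => ∃ h : e ∈ G.edgeSet, ω ⟨e, h⟩ = true)

theorem mem_opn (ω : Config G) (e : Sym2 V) :
    e ∈ opn G ω ↔ ∃ h : e ∈ G.edgeSet, ω ⟨e, h⟩ = true := by simp [opn]

theorem opn_sub (ω : Config G) : opn G ω ⊆ EE G := fun e he =>
  (mem_EE G e).2 ((mem_opn G ω e).1 he).1

theorem weight_eq (p : ℝ) (ω : Config G) : weight G p ω =
    p ^ (opn G ω).card * (1 - p) ^ ((EE G).card - (opn G ω).card) := by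
  unfold weight
  have h1 : ∏ e : G.edgeSet, (if ω e = true then p else 1 - p) =
      ∏ e ∈ EE G, (if e ∈ opn G ω then p else 1 - p) := by
    rw [Finset.prod_subtype (EE G) (p := fun e => e ∈ G.edgeSet) (mem_EE G)]
    refine Finset.prod_congr rfl fun e _ => ?_
    have : (e : Sym2 V) ∈ opn G ω ↔ ω e = true := by
      rw [mem_opn]
      exact ⟨fun ⟨_, h⟩ => h, fun h => ⟨e.2, h⟩⟩
    simp only [this]
  rw [h1, Finset.prod_ite, Finset.prod_const, Finset.prod_const]
  have h2 : (EE G).filter (fun e => e ∈ opn G ω) = opn G ω := by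
    ext e
    rw [Finset.mem_filter]
    exact ⟨fun h => h.2, fun h => ⟨opn_sub G ω h, h⟩⟩
  have h3 : (EE G).filter (fun e => e ∉ opn G ω) = EE G \ opn G ω := by
    ext e
    rw [Finset.mem_filter, Finset.mem_sdiff]
  rw [h2, h3, Finset.card_sdiff_of_subset (opn_sub G ω)]

/-- The configuration with prescribed open bonds. -/
def cfg (S : Finset (Sym2 V)) : Config G := fun e => decide ((e : Sym2 V) ∈ S)

theorem opn_cfg (S : Finset (Sym2 V)) (hS : S ⊆ EE G) : opn G (cfg G S) = S := by
  ext e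
  rw [mem_opn]
  constructor
  · rintro ⟨_, h⟩
    exact of_decide_eq_true h
  · intro he
    exact ⟨(mem_EE G e).1 (hS he), decide_eq_true he⟩

theorem expect_eq (p : ℝ) (f : Config G → ℝ) (F : Finset (Sym2 V) → ℝ)
    (h : ∀ ω, f ω = F (opn G ω)) : expect G p f = Ex (EE G) p F := by
  unfold expect Ex
  refine Finset.sum_bij' (fun ω _ => opn G ω) (fun S _ => cfg G S)
    ?_ ?_ ?_ ?_ ?_
  · intro ω _
    exact Finset.mem_powerset.2 (opn_sub G ω)
  · intro S _
    exact Finset.mem_univ _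
  · intro ω _
    funext e
    have : (e : Sym2 V) ∈ opn G ω ↔ ω e = true := by
      rw [mem_opn]
      exact ⟨fun ⟨_, h⟩ => h, fun h => ⟨e.2, h⟩⟩
    show decide ((e : Sym2 V) ∈ opn G ω) = ω e
    rw [Bool.eq_iff_iff, decide_eq_true_iff, this]
  · intro S hS
    exact opn_cfg G S (Finset.mem_powerset.1 hS)
  · intro ω _
    rw [weight_eq, h]

theorem prob_eq (p : ℝ) (A : Config G → Prop) (B : Finset (Sym2 V) → Prop)
    (h : ∀ ω, A ω ↔ B (opn G ω)) : prob G p A = Ex (EE G) p (fun S => ind (B S)) := by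
  rw [← expect_eq G p (fun ω => ind (A ω)) (fun S => ind (B S)) (fun ω => ind_congr (h ω))]
  unfold prob expect
  refine Finset.sum_congr rfl fun ω _ => ?_
  by_cases hA : A ω
  · beta_reduce
    rw [if_pos hA, ind_true hA, mul_one]
  · beta_reduce
    rw [if_neg hA, ind_false hA, mul_zero]

theorem occ_R (ω : Config G) (x y : V) : (occupied G ω).Reachable x y ↔ R (opn G ω) x y := by
  have : ((opn G ω : Finset (Sym2 V)) : Set (Sym2 V)) =
      {e | ∃ h : e ∈ G.edgeSet, ω ⟨e, h⟩ = true} := by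
    ext e
    simp [mem_opn]
  unfold R occupied
  rw [this]

theorem cluster_eq (ω : Config G) (x : V) : cluster G ω x = Cl (opn G ω) x := by
  ext y
  rw [mem_Cl, ← occ_R]
  simp [cluster]

theorem tau_eq (p : ℝ) (x y : V) : tau G p x y = tau2 (EE G) p x y :=
  prob_eq G p _ (fun S => R S x y) fun ω => occ_R G ω x y

theorem triangle_eq (p : ℝ) (x y : V) : triangle G p x y = tri2 (EE G) p x y := by
  unfold triangle tri2
  simp_rw [tau_eq]

theorem maxCluster_eq (ω : Config G) : maxCluster G ω = maxC (opn G ω) := by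
  unfold maxCluster maxC
  simp_rw [cluster_eq]

theorem chi_eq (x₀ : V) (p : ℝ) : chi G x₀ p = Ex (EE G) p (fun S => ((Cl S x₀).card : ℝ)) :=
  expect_eq G p _ (fun S => ((Cl S x₀).card : ℝ)) fun ω => by rw [cluster_eq]

theorem trans_EE (h : IsTransitive G) : ∀ x y : V, ∃ σ : V ≃ V, σ x = y ∧
    ∀ e, Sym2.map σ e ∈ EE G ↔ e ∈ EE G := by
  intro x y
  obtain ⟨φ, hφ⟩ := h x y
  refine ⟨φ.toEquiv, hφ, fun e => ?_⟩
  rw [mem_EE, mem_EE]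
  induction e using Sym2.ind with
  | _ a b => exact φ.map_adj_iff

theorem markov_max {p w k n ε : ℝ} (hp0 : 0 ≤ p) (hp1 : p ≤ 1) (hw : 0 < w) (hk : 0 < k)
    (hn : 0 ≤ ε * n) (hm : expect G p (fun ω => (maxCluster G ω : ℝ)) ≤ 21 * ε * n + 7 * k) :
    prob G p (fun ω => w * (k + ε * n) ≤ (maxCluster G ω : ℝ)) ≤ 21 / w := by
  have hpos : 0 < k + ε * n := by linarith
  have hm2 : expect G p (fun ω => (maxCluster G ω : ℝ)) =
      Ex (EE G) p (fun S => (maxC S : ℝ)) :=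
    expect_eq G p _ (fun S => (maxC S : ℝ)) (fun ω => by rw [maxCluster_eq])
  have hq : prob G p (fun ω => w * (k + ε * n) ≤ (maxCluster G ω : ℝ)) =
      Ex (EE G) p (fun S => ind (w * (k + ε * n) ≤ (maxC S : ℝ))) :=
    prob_eq G p _ (fun S => w * (k + ε * n) ≤ (maxC S : ℝ)) (fun ω => by rw [maxCluster_eq])
  rw [hm2] at hm
  have hmk : w * (k + ε * n) * Ex (EE G) p
      (fun S => ind (w * (k + ε * n) ≤ (maxC S : ℝ))) ≤
      Ex (EE G) p (fun S => (maxC S : ℝ)) := by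
    rw [← Ex_mul_left]
    refine Ex_mono hp0 hp1 fun S _ => ?_
    by_cases h : w * (k + ε * n) ≤ (maxC S : ℝ)
    · rw [ind_true h]; linarith
    · rw [ind_false h, mul_zero]; positivity
  rw [← hq] at hmk
  generalize prob G p (fun ω => w * (k + ε * n) ≤ (maxCluster G ω : ℝ)) = q at hmk ⊢
  rw [le_div_iff₀ hw]
  refine le_of_mul_le_mul_right ?_ hpos
  linarith

theorem hN_of [DecidableRel G.Adj] {Ω : ℕ} (hreg : G.IsRegularOfDegree Ω) (u : V)
    (inst : DecidablePred (fun v => s(u, v) ∈ EE G)) :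
    (@Finset.filter V (fun v => s(u, v) ∈ EE G) inst Finset.univ).card = Ω := by
  rw [← hreg u, ← SimpleGraph.card_neighborFinset_eq_degree]
  congr 1
  ext v
  simp [mem_EE]

end final
end Perc2

open Percolation in
/-- Theorem 1.4(i) (Supercritical phase): upper bounds on the largest
supercritical cluster. -/
theorem supercritical_largest_cluster :
    ∃ b₀ : ℝ, 0 < b₀ ∧
      ∀ (V : Type) [Fintype V] [DecidableEq V]
        (G : SimpleGraph V) [DecidableRel G.Adj],
        G.Connected → IsTransitive G →
        ∀ Ω : ℕ, G.IsRegularOfDegree Ω →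
        ∀ (x₀ : V) (lam : ℝ), 0 < lam →
        1 < lam * (Fintype.card V : ℝ) ^ ((1 : ℝ) / 3) →
        lam * (Fintype.card V : ℝ) ^ ((1 : ℝ) / 3) < (Fintype.card V : ℝ) →
        b₀⁻¹ ≤ lam * (Fintype.card V : ℝ) ^ ((1 : ℝ) / 3) →
        ∀ pc : ℝ, 0 < pc → pc < 1 →
        chi G x₀ pc = lam * (Fintype.card V : ℝ) ^ ((1 : ℝ) / 3) →
        ∀ a₀ : ℝ, a₀ ≤ b₀ →
        (∀ x y : V, triangle G pc x y ≤ kron x y + a₀) →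
        ∀ ε : ℝ, 0 ≤ ε →
        ∀ p : ℝ, p = pc + ε * (Ω : ℝ)⁻¹ → p ≤ 1 →
        (expect G p (fun ω => (maxCluster G ω : ℝ)) ≤
            21 * ε * (Fintype.card V : ℝ) +
              7 * (Fintype.card V : ℝ) ^ ((2 : ℝ) / 3)) ∧
        (∀ w : ℝ, 0 < w →
          prob G p (fun ω =>
              w * ((Fintype.card V : ℝ) ^ ((2 : ℝ) / 3) + ε * (Fintype.card V : ℝ)) ≤
                (maxCluster G ω : ℝ)) ≤ 21 / w) := by
  refine ⟨1 / 1000, by norm_num, ?_⟩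
  intro V _ _ G _ hconn htrans Ω hreg x₀ lam _ h1 h2 h3 pc hpc0 hpc1 hchi a₀ ha htri ε hε p hp hp1
  have hinv := Perc2.inv_Ex (Perc2.trans_EE G htrans)
  have hE : ∀ u, s(u, u) ∉ Perc2.EE G := by
    intro u hu
    rw [Perc2.mem_EE] at hu
    exact G.loopless.irrefl u hu
  have htri2 : ∀ x y, x ≠ y → Perc2.tri2 (Perc2.EE G) pc x y ≤ a₀ := by
    intro x y hxy
    have := htri x y
    rw [Perc2.triangle_eq, kron, if_neg hxy, zero_add] at this
    exact this
  -- there is a bond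
  have hcard : 1 < Fintype.card V := by
    have : (1 : ℝ) < Fintype.card V := h1.trans h2
    exact_mod_cast this
  have hnt : Nontrivial V := Fintype.one_lt_card_iff_nontrivial.1 hcard
  obtain ⟨y₀, hy₀⟩ : ∃ y, G.Adj x₀ y := by
    obtain ⟨z, hz⟩ := exists_ne x₀
    obtain ⟨w⟩ := hconn.preconnected x₀ z
    cases w with
    | nil => exact absurd rfl hz
    | cons h _ => exact ⟨_, h⟩
  have hpa : pc ≤ a₀ :=
    (Perc2.p_le_tri hpc0.le hpc1.le ((Perc2.mem_EE G _).2 hy₀)).trans (htri2 _ _ hy₀.ne)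
  have hΩ1 : 1 ≤ Ω := by
    rw [← hreg x₀]
    exact (SimpleGraph.degree_pos_iff_exists_adj G x₀).2 ⟨y₀, hy₀⟩
  have hX : lam * (Fintype.card V : ℝ) ^ ((1 : ℝ) / 3) ≤
      1 + (Ω : ℝ) * pc * (lam * (Fintype.card V : ℝ) ^ ((1 : ℝ) / 3)) := by
    have hp2 : pc ≤ 1 / 2 := by linarith
    refine Perc2.chi_bound (E := Perc2.EE G) x₀ (fun u => Perc2.hN_of G hreg u _) hpc0.le hp2 (fun x => ?_)
    rw [← hchi, Perc2.chi_eq]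
    exact hinv pc (fun C => (C.card : ℝ)) (fun C D h => congrArg Nat.cast h) x x₀
  have hΩp : 999 / 1000 ≤ (Ω : ℝ) * pc := by
    clear hinv htri htri2 hE
    generalize lam * (Fintype.card V : ℝ) ^ ((1 : ℝ) / 3) = X at hX h3
    generalize (Ω : ℝ) * pc = t at hX ⊢
    norm_num at h3
    nlinarith
  have hmain : expect G p (fun ω => (maxCluster G ω : ℝ)) ≤
      21 * ε * (Fintype.card V : ℝ) + 7 * (Fintype.card V : ℝ) ^ ((2 : ℝ) / 3) := by
    rw [Perc2.expect_eq G p _ (fun S => (Perc2.maxC S : ℝ))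
      (fun ω => by rw [Perc2.maxCluster_eq]), hp]
    exact Perc2.maxC_Ex x₀ hE (fun u => Perc2.hN_of G hreg u _) hinv hpc0.le hpa ha hΩp htri2 hε hΩ1 (by rw [← hp]; exact hp1)
  refine ⟨hmain, fun w hw => ?_⟩
  have hp0 : 0 ≤ p := by
    rw [hp]; positivity
  have hV : (0 : ℝ) < Fintype.card V := by exact_mod_cast (by omega : 0 < Fintype.card V)
  have hk : 0 < (Fintype.card V : ℝ) ^ ((2 : ℝ) / 3) := Real.rpow_pos_of_pos hV _
  have hεV : 0 ≤ ε * (Fintype.card V : ℝ) := mul_nonneg hε hV.le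
  exact Perc2.markov_max G hp0 hp1 hw hk hεV hmain
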